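/- arXiv:2308.06559 — 13 statements merged into one kernel-verified Lean document; each statement's English description precedes it below -/
import Mathlib

section
/- Let A₁, …, A_t be subgroups of a finite abelian group G, all isomorphic to one another, and suppose each Aᵢ has a complement in G. If the smallest prime divisor of |A₁| is at least t, then A₁, …, A_t have a common complement in G. -/
/-- `H` is a complement of `A` in `G`: `G = AH` and `A ∩ H = 1`. -/
def IsComplementOf {G : Type*} [Group G] (H A : Subgroup G) : Prop :=
  A ⊔ H = ⊤ ∧ A ⊓ H = ⊥

/-- A finite `p`-group is not the union of at most `p` proper subgroups. -/
theorem IsPGroup.exists_forall_notMem {X ι : Type*} [Group X] [Finite X] [Fintype ι] {p : ℕ}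
    (hp : p.Prime) (hX : IsPGroup p X) (hι : Fintype.card ι ≤ p) (B : ι → Subgroup X)
    (hB : ∀ i, B i ≠ ⊤) : ∃ x, ∀ i, x ∉ B i := by
  classical
  have := Fact.mk hp
  have := Fintype.ofFinite X
  by_contra! hcov
  obtain ⟨i₀, -⟩ := hcov 1
  have hcard (i : ι) : Nat.card (B i) * p ≤ Nat.card X := by
    obtain ⟨n, hn⟩ := hX.index (B i)
    have hn0 : n ≠ 0 := fun h => hB i (Subgroup.index_eq_one.mp (by rw [hn, h, pow_zero]))
    rw [← (B i).card_mul_index, hn]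
    exact Nat.mul_le_mul_left _ (Nat.le_self_pow hn0 p)
  have hsub : (Finset.univ : Finset X).erase 1 ⊆
      Finset.univ.biUnion fun i => (Finset.univ.filter (· ∈ B i)).erase 1 := by
    intro x hx
    obtain ⟨i, hi⟩ := hcov x
    simp only [Finset.mem_biUnion, Finset.mem_erase, Finset.mem_filter, Finset.mem_univ,
      true_and, and_true] at hx ⊢
    exact ⟨i, hx, hi⟩
  have hle : Nat.card X - 1 ≤ ∑ i, (Nat.card (B i) - 1) := by
    have h := (Finset.card_le_card hsub).trans Finset.card_biUnion_le
    rw [Finset.card_erase_of_mem (Finset.mem_univ _), Finset.card_univ,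
      ← Nat.card_eq_fintype_card] at h
    refine h.trans (Finset.sum_le_sum fun i _ => ?_)
    rw [Finset.card_erase_of_mem (by simp [(B i).one_mem]), ← Fintype.card_subtype,
      ← Nat.card_eq_fintype_card]
  have hterm (i : ι) : p * (Nat.card (B i) - 1) ≤ Nat.card X - p := by
    have := hcard i
    rw [Nat.mul_sub, mul_one, mul_comm]
    omega
  have hpX : p ≤ Nat.card X := (Nat.le_mul_of_pos_left p Nat.card_pos).trans (hcard i₀)
  have hfin : p * (Nat.card X - 1) ≤ p * (Nat.card X - p) := by
    refine (Nat.mul_le_mul_left p hle).trans ?_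
    rw [Finset.mul_sum]
    refine (Finset.sum_le_card_nsmul _ _ _ fun i _ => hterm i).trans ?_
    rw [smul_eq_mul, Finset.card_univ]
    exact Nat.mul_le_mul_right _ hι
  have := Nat.le_of_mul_le_mul_left hfin hp.pos
  have := hp.two_le
  omega

/-- At most `p` subgroups, each with an element of order `p ^ (j + 1)` whose `p ^ j`-th power is
not a `p ^ (j + 1)`-th power in `G`, admit a character of exponent `p ^ (j + 1)` that is of full
order on each of them. -/
theorem exists_character_pow_ne_one {G ι : Type*} [CommGroup G] [Finite G] [Fintype ι]
    {p j : ℕ} (hp : p.Prime) (hι : Fintype.card ι ≤ p) (A : ι → Subgroup G)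
    (hA : ∀ i, ∃ a ∈ A i, a ^ p ^ (j + 1) = 1 ∧ ∀ g : G, g ^ p ^ (j + 1) ≠ a ^ p ^ j) :
    ∃ χ : G →* ℂˣ, (∀ g, χ g ^ p ^ (j + 1) = 1) ∧
      ∀ i, ∃ a ∈ A i, a ^ p ^ (j + 1) = 1 ∧ χ a ^ p ^ j ≠ 1 := by
  set P : Subgroup G := (powMonoidHom (p ^ (j + 1)) : G →* G).range
  have hP (χ : G ⧸ P →* ℂˣ) (g : G ⧸ P) : χ g ^ p ^ (j + 1) = 1 := by
    induction g using QuotientGroup.induction_on with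
    | H g =>
      rw [← map_pow, ← QuotientGroup.mk_pow, (QuotientGroup.eq_one_iff (N := P) (g ^ _)).mpr ⟨g, rfl⟩,
        map_one]
  let B (i : ι) : Subgroup (G ⧸ P →* ℂˣ) :=
    { carrier := {χ | ∀ a ∈ A i, a ^ p ^ (j + 1) = 1 → χ (a : G ⧸ P) ^ p ^ j = 1}
      one_mem' := by simp
      mul_mem' := fun {φ ψ} hφ hψ a ha h => by
        rw [MonoidHom.mul_apply, mul_pow, hφ a ha h, hψ a ha h, one_mul]
      inv_mem' := fun {φ} hφ a ha h => by
        rw [MonoidHom.inv_apply, inv_pow, hφ a ha h, inv_one] }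
  have hB (i : ι) : B i ≠ ⊤ := by
    obtain ⟨a, ha, ha1, hag⟩ := hA i
    have hne : ((a ^ p ^ j : G) : G ⧸ P) ≠ 1 := fun h => by
      obtain ⟨g, hg⟩ := (QuotientGroup.eq_one_iff _).mp h
      exact hag g hg
    obtain ⟨χ, hχ⟩ := CommGroup.exists_apply_ne_one_of_hasEnoughRootsOfUnity (G ⧸ P) ℂ hne
    intro h
    have hmem : χ ∈ B i := h ▸ Subgroup.mem_top χ
    exact hχ (by rw [QuotientGroup.mk_pow, map_pow]; exact hmem a ha ha1)
  have : Finite (G ⧸ P →* ℂˣ) :=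
    Nat.finite_of_card_ne_zero
      (by rw [CommGroup.card_monoidHom_of_hasEnoughRootsOfUnity]; exact Nat.card_pos.ne')
  obtain ⟨χ, hχ⟩ := IsPGroup.exists_forall_notMem hp
    (fun χ => ⟨j + 1, MonoidHom.ext fun g => hP χ g⟩) hι B hB
  refine ⟨χ.comp (QuotientGroup.mk' P), fun g => hP χ _, fun i => ?_⟩
  by_contra! h
  exact hχ i fun a ha ha1 => h a ha ha1

/-- Whether a subgroup is killed by `n` is determined by the numbers of its `n`-torsion points. -/
theorem Subgroup.le_ker_pow_of_card_inf_eq {G : Type*} [CommGroup G] [Finite G]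
    {A B : Subgroup G} (h : ∀ n : ℕ, Nat.card ↥(A ⊓ (powMonoidHom n : G →* G).ker) =
      Nat.card ↥(B ⊓ (powMonoidHom n : G →* G).ker)) {n : ℕ}
    (hA : A ≤ (powMonoidHom n : G →* G).ker) : B ≤ (powMonoidHom n : G →* G).ker := by
  have h0 : (powMonoidHom 0 : G →* G).ker = ⊤ := by
    ext; simp [MonoidHom.mem_ker]
  have hAB := h 0
  have hn := h n
  rw [h0, inf_top_eq, inf_top_eq] at hAB
  rw [inf_eq_left.mpr hA, hAB] at hn
  exact inf_eq_left.mp (Subgroup.eq_of_le_of_card_ge inf_le_left hn.le)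

/-- If `a ∈ A` has order dividing `q` and `χ a` generates the group of values of a character `χ`
with `χ ^ q = 1`, then `A` is the product of `⟨a⟩` and `A ∩ ker χ`, so the numbers of torsion
points of `A` and of `A ∩ ker χ` determine each other. -/
theorem Subgroup.card_inf_ker_pow_eq {G : Type*} [CommGroup G]
    {A : Subgroup G} {χ : G →* ℂˣ} {a : G} (ha : a ∈ A)
    (hgen : ∀ g, ∃ z : ℤ, χ (a ^ z) = χ g) (hinj : ∀ z : ℤ, χ (a ^ z) = 1 → a ^ z = 1) (n : ℕ) :
    Nat.card ↥(A ⊓ (powMonoidHom n : G →* G).ker) =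
      Nat.card ↥((A ⊓ χ.ker) ⊓ (powMonoidHom n : G →* G).ker) *
        Nat.card ↥(χ.range ⊓ (powMonoidHom n : ℂˣ →* ℂˣ).ker) := by
  set T := (powMonoidHom n : G →* G).ker
  have hrange : (χ.domRestrict (A ⊓ T)).range = χ.range ⊓ (powMonoidHom n : ℂˣ →* ℂˣ).ker := by
    ext y
    constructor
    · rintro ⟨⟨x, -, hx⟩, rfl⟩
      refine ⟨⟨x, rfl⟩, ?_⟩
      change χ x ^ n = 1
      rw [← map_pow, show x ^ n = 1 from hx, map_one]
    · rintro ⟨⟨g, rfl⟩, hg⟩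
      obtain ⟨z, hz⟩ := hgen g
      refine ⟨⟨a ^ z, A.zpow_mem ha z, ?_⟩, hz⟩
      change (a ^ z) ^ n = 1
      rw [← zpow_natCast, ← zpow_mul]
      apply hinj
      rw [zpow_mul, zpow_natCast, map_pow, hz]
      exact hg
  have hker : (χ.domRestrict (A ⊓ T)).ker = ((A ⊓ χ.ker) ⊓ T).subgroupOf (A ⊓ T) := by
    ext ⟨x, hxA, hxT⟩
    simp only [MonoidHom.mem_ker, MonoidHom.domRestrict_apply, Subgroup.mem_subgroupOf,
      Subgroup.mem_inf]
    exact ⟨fun h => ⟨⟨hxA, h⟩, hxT⟩, fun h => h.1.2⟩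
  rw [← (χ.domRestrict (A ⊓ T)).ker.card_mul_index, Subgroup.index_ker, hrange, hker,
    Nat.card_congr (Subgroup.subgroupOfEquivOfLe (inf_le_inf_right T inf_le_left)).toEquiv]

/-- Pure subgroups `A i` of a finite abelian group with the same numbers of `n`-torsion points have
a common complement in every subgroup containing them, provided that there are at most as many of
them as the smallest prime divisor of their order. -/
theorem exists_common_complement_of_pure {G ι : Type*} [CommGroup G] [Finite G] [Fintype ι]
    (i₀ : ι) (K : Subgroup G) (A : ι → Subgroup G) (hAK : ∀ i, A i ≤ K)
    (hpure : ∀ i (n : ℕ) (g : G), g ^ n ∈ A i → ∃ b ∈ A i, b ^ n = g ^ n)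
    (hcard : ∀ i (n : ℕ), Nat.card ↥(A i₀ ⊓ (powMonoidHom n : G →* G).ker) =
      Nat.card ↥(A i ⊓ (powMonoidHom n : G →* G).ker))
    (hprime : ∀ p : ℕ, p.Prime → p ∣ Nat.card (A i₀) → Fintype.card ι ≤ p) :
    ∃ H ≤ K, ∀ i, K ≤ A i ⊔ H ∧ A i ⊓ H = ⊥ := by
  induction hN : Nat.card (A i₀) using Nat.strong_induction_on generalizing K A with
  | _ N ih =>
  subst hN
  by_cases hbot : A i₀ = ⊥
  · have hA (i : ι) : A i = ⊥ := by
      have h := Subgroup.le_ker_pow_of_card_inf_eq (hcard i) (n := 1) (by rw [hbot]; exact bot_le)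
      exact (Subgroup.eq_bot_iff_forall _).mpr fun x hx => by
        simpa [MonoidHom.mem_ker] using h hx
    exact ⟨K, le_rfl, fun i => ⟨le_sup_right, by rw [hA i, bot_inf_eq]⟩⟩
  obtain ⟨p, hp, hpdvd⟩ := Nat.exists_prime_and_dvd (n := Nat.card (A i₀))
    (fun h => hbot (Subgroup.card_eq_one.mp h))
  have := Fact.mk hp
  have hle := hprime p hp hpdvd
  have he0 : Monoid.exponent (A i₀) ≠ 0 := Monoid.exponent_ne_zero_of_finite
  have hpe : p ∣ Monoid.exponent (A i₀) := by
    obtain ⟨x, hx⟩ := exists_prime_orderOf_dvd_card' p hpdvd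
    exact hx ▸ Monoid.order_dvd_exponent x
  obtain ⟨k, m, hm, hkm⟩ := Nat.exists_eq_pow_mul_and_not_dvd he0 p hp.ne_one
  obtain ⟨j, rfl⟩ : ∃ j, k = j + 1 := Nat.exists_eq_succ_of_ne_zero (by
    rintro rfl
    exact hm (by simpa [hkm] using hpe))
  have hexp (i : ι) (a : G) (ha : a ∈ A i) : a ^ (p ^ (j + 1) * m) = 1 :=
    Subgroup.le_ker_pow_of_card_inf_eq (hcard i) (n := p ^ (j + 1) * m) (fun x hx => by
      have := Monoid.pow_exponent_eq_one (⟨x, hx⟩ : A i₀)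
      rw [hkm] at this
      exact congrArg Subtype.val this) ha
  have hnot (i : ι) : ∃ a ∈ A i, a ^ (p ^ j * m) ≠ 1 := by
    by_contra! h
    have h' := Subgroup.le_ker_pow_of_card_inf_eq (fun n => (hcard i n).symm)
      (n := p ^ j * m) (fun x hx => h x hx)
    have hdvd : Monoid.exponent (A i₀) ∣ p ^ j * m :=
      Monoid.exponent_dvd_of_forall_pow_eq_one fun x => Subtype.ext (h' x.2)
    have hpos : 0 < p ^ j * m := by
      have : m ≠ 0 := fun h => hm (h ▸ dvd_zero p)
      have := hp.pos
      positivity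
    have := Nat.le_of_dvd hpos hdvd
    rw [hkm, pow_succ'] at this
    have := hp.two_le
    nlinarith
  obtain ⟨χ, hχ, hχA⟩ := exists_character_pow_ne_one (j := j) hp hle A fun i => by
    obtain ⟨a, ha, hne⟩ := hnot i
    refine ⟨a ^ m, (A i).pow_mem ha m, by rw [← pow_mul, mul_comm, hexp i a ha], fun g hg => ?_⟩
    obtain ⟨b, hb, hbg⟩ := hpure i (p ^ (j + 1)) g
      (hg ▸ (A i).pow_mem ((A i).pow_mem ha m) _)
    have h1 : ((a ^ m) ^ p ^ j) ^ m = 1 := by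
      rw [← hg, ← hbg, ← pow_mul, hexp i b hb]
    have h2 : ((a ^ m) ^ p ^ j) ^ p = 1 := by
      rw [← pow_mul, ← pow_mul, ← pow_succ, mul_comm, hexp i a ha]
    have hcop : Nat.Coprime m p := ((Nat.Prime.coprime_iff_not_dvd hp).mpr hm).symm
    have h3 := Nat.dvd_gcd (orderOf_dvd_of_pow_eq_one h1) (orderOf_dvd_of_pow_eq_one h2)
    rw [hcop.gcd_eq_one, Nat.dvd_one, orderOf_eq_one_iff, ← pow_mul, mul_comm] at h3
    exact hne h3
  choose a ha ha1 haχ using hχA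
  have horder (i : ι) : orderOf (χ (a i)) = p ^ (j + 1) := orderOf_eq_prime_pow (haχ i) (hχ _)
  have hinj (i : ι) (z : ℤ) (hz : χ (a i ^ z) = 1) : a i ^ z = 1 := by
    rw [map_zpow, ← orderOf_dvd_iff_zpow_eq_one, horder] at hz
    exact orderOf_dvd_iff_zpow_eq_one.mp
      ((Int.natCast_dvd_natCast.mpr (orderOf_dvd_of_pow_eq_one (ha1 i))).trans hz)
  have hgen (i : ι) (g : G) : ∃ z : ℤ, χ (a i ^ z) = χ g := by
    have : NeZero (p ^ (j + 1)) := ⟨pow_ne_zero _ hp.ne_zero⟩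
    have hprim : IsPrimitiveRoot (χ (a i)) (p ^ (j + 1)) := horder i ▸ IsPrimitiveRoot.orderOf _
    have hmem : χ g ∈ Subgroup.zpowers (χ (a i)) := by
      rw [hprim.zpowers_eq]
      exact hχ g
    obtain ⟨z, hz⟩ := Subgroup.mem_zpowers_iff.mp hmem
    exact ⟨z, by rw [map_zpow, hz]⟩
  have hsplit (i : ι) (g : G) : ∃ z : ℤ, g * a i ^ z ∈ χ.ker := by
    obtain ⟨z, hz⟩ := hgen i g⁻¹
    exact ⟨z, by rw [MonoidHom.mem_ker, map_mul, hz, ← map_mul, mul_inv_cancel, map_one]⟩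
  have hlt : Nat.card ↥(A i₀ ⊓ χ.ker) < Nat.card (A i₀) := by
    refine lt_of_not_ge fun h => haχ i₀ ?_
    have hmem : a i₀ ∈ A i₀ ⊓ χ.ker := by
      rw [Subgroup.eq_of_le_of_card_ge inf_le_left h]
      exact ha i₀
    rw [MonoidHom.mem_ker.mp hmem.2, one_pow]
  obtain ⟨H, hHK, hH⟩ := ih _ hlt (K ⊓ χ.ker) (fun i => A i ⊓ χ.ker)
    (fun i => inf_le_inf_right _ (hAK i))
    (fun i n g hg => by
      obtain ⟨b, hb, hbg⟩ := hpure i n g hg.1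
      obtain ⟨z, hz⟩ := hsplit i b
      refine ⟨b * a i ^ z, ⟨mul_mem hb ((A i).zpow_mem (ha i) z), hz⟩, ?_⟩
      have hzn : (a i ^ z) ^ n = 1 := by
        have h1 : χ (b ^ n * (a i ^ z) ^ n) = 1 := by
          rw [← mul_pow, map_pow, MonoidHom.mem_ker.mp hz, one_pow]
        rw [map_mul, hbg, MonoidHom.mem_ker.mp hg.2, one_mul] at h1
        rw [← zpow_natCast, ← zpow_mul] at h1 ⊢
        exact hinj i _ h1
      rw [mul_pow, hzn, mul_one, hbg])
    (fun i n => by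
      have h := hcard i n
      rw [Subgroup.card_inf_ker_pow_eq (ha i₀) (hgen i₀) (hinj i₀) n,
        Subgroup.card_inf_ker_pow_eq (ha i) (hgen i) (hinj i) n] at h
      have hpos : 0 < Nat.card ↥(χ.range ⊓ (powMonoidHom n : ℂˣ →* ℂˣ).ker) := by
        have : Finite χ.range := Finite.of_surjective _ χ.rangeRestrict_surjective
        have : Finite ↥(χ.range ⊓ (powMonoidHom n : ℂˣ →* ℂˣ).ker) :=
          Finite.of_injective _ (Subgroup.inclusion_injective inf_le_left)
        exact Nat.card_pos
      exact Nat.eq_of_mul_eq_mul_right hpos h)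
    (fun q hq hdvd => hprime q hq (hdvd.trans (Subgroup.card_dvd_of_le inf_le_left)))
    rfl
  refine ⟨H, hHK.trans inf_le_left, fun i => ⟨fun x hx => ?_, ?_⟩⟩
  · obtain ⟨z, hz⟩ := hsplit i x
    have hmem : x * a i ^ z ∈ A i ⊔ H :=
      sup_le_sup_right inf_le_left H
        ((hH i).1 ⟨mul_mem hx (K.zpow_mem (hAK i (ha i)) z), hz⟩)
    exact (Subgroup.mul_mem_cancel_right _
      (Subgroup.mem_sup_left ((A i).zpow_mem (ha i) z))).mp hmem
  · rw [← (hH i).2, inf_assoc, inf_eq_right.mpr (hHK.trans inf_le_right)]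

/-- **Theorem A.** Let `A₁, …, A_t` be pairwise isomorphic complemented subgroups of a
finite abelian group `G`. If the smallest prime divisor of `|A₁|` is at least `t`,
then `A₁, …, A_t` have a common complement in `G`. -/
theorem common_complement_of_isomorphic_complemented
    {G : Type*} [CommGroup G] [Fintype G] {t : ℕ} (ht : 0 < t)
    (A : Fin t → Subgroup G)
    (hiso : ∀ i j, Nonempty (↥(A i) ≃* ↥(A j)))
    (hcompl : ∀ i, ∃ H : Subgroup G, IsComplementOf H (A i))
    (hprime : ∀ p : ℕ, p.Prime → p ∣ Nat.card (A ⟨0, ht⟩) → t ≤ p) :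
    ∃ H : Subgroup G, ∀ i, IsComplementOf H (A i) := by
  obtain ⟨H, -, hH⟩ := exists_common_complement_of_pure ⟨0, ht⟩ ⊤ A (fun _ => le_top)
    (fun i n g hg => by
      obtain ⟨H, hsup, hinf⟩ := hcompl i
      obtain ⟨b, hb, h, hh, rfl⟩ := Subgroup.mem_sup.mp (hsup ▸ Subgroup.mem_top g)
      rw [mul_pow] at hg ⊢
      have hmem : h ^ n ∈ A i ⊓ H :=
        ⟨(Subgroup.mul_mem_cancel_left _ ((A i).pow_mem hb n)).mp hg, H.pow_mem hh n⟩
      rw [hinf, Subgroup.mem_bot] at hmem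
      exact ⟨b, hb, by rw [hmem, mul_one]⟩)
    (fun i n => by
      obtain ⟨e⟩ := hiso ⟨0, ht⟩ i
      have key (B : Subgroup G) : Nat.card ↥(B ⊓ (powMonoidHom n : G →* G).ker) =
          Nat.card {x : B // x ^ n = 1} :=
        Nat.card_congr
          { toFun := fun x => ⟨⟨x, x.2.1⟩, Subtype.ext x.2.2⟩
            invFun := fun x => ⟨x, x.1.2, congrArg Subtype.val x.2⟩
            left_inv := fun _ => rfl
            right_inv := fun _ => rfl }
      rw [key, key]
      exact Nat.card_congr (e.toEquiv.subtypeEquiv fun x => by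
        change x ^ n = 1 ↔ e x ^ n = 1
        rw [← map_pow, map_eq_one_iff e e.injective]))
    (by simpa using hprime)
  exact ⟨H, fun i => ⟨top_le_iff.mp (hH i).1, (hH i).2⟩⟩
end

section
/- Let A₁, …, Aₙ be subgroups of a finite abelian group G. Then A₁, …, Aₙ have a common transversal in G if and only if A₁, …, Aₙ have a common transversal in the product subgroup A₁A₂⋯Aₙ. -/
/-- `T` is a transversal of the subgroup `A` in `G`: it contains exactly one
element from each coset of `A`. -/
def IsTransversal {G : Type*} [Group G] (A : Subgroup G) (T : Set G) : Prop :=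
  ∀ g : G, ∃! t, t ∈ T ∧ (QuotientGroup.mk t : G ⧸ A) = QuotientGroup.mk g

lemma IsTransversal.preimage_subtype {G : Type*} [Group G] {A P : Subgroup G} (hAP : A ≤ P)
    {T : Set G} (hT : IsTransversal A T) :
    IsTransversal (A.subgroupOf P) (Subtype.val ⁻¹' T : Set P) := by
  intro g
  obtain ⟨t, ⟨htT, ht⟩, huniq⟩ := hT g
  have htA : t⁻¹ * (g : G) ∈ A := (QuotientGroup.eq.mp ht :)
  have htP : t ∈ P := by
    have h := P.mul_mem g.2 (P.inv_mem (hAP htA))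
    rwa [mul_inv_rev, inv_inv, mul_inv_cancel_left] at h
  refine ⟨⟨t, htP⟩, ⟨htT, QuotientGroup.eq.mpr htA⟩, ?_⟩
  rintro s ⟨hsT, hs⟩
  exact Subtype.ext (huniq s ⟨hsT, QuotientGroup.eq.mpr (QuotientGroup.eq.mp hs :)⟩)

/-- The translates of a transversal of `A` in `P` by representatives of the cosets of `P`
form a transversal of `A` in `G`. -/
lemma IsTransversal.image2_out_mul {G : Type*} [Group G] {A P : Subgroup G} (hAP : A ≤ P)
    {T : Set P} (hT : IsTransversal (A.subgroupOf P) T) :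
    IsTransversal A (Set.image2 (fun (q : G ⧸ P) (t : P) => q.out * (t : G)) Set.univ T) := by
  intro g
  set r : G := (QuotientGroup.mk g : G ⧸ P).out
  have hrg : r⁻¹ * g ∈ P := QuotientGroup.eq.mp (QuotientGroup.out_eq' _)
  obtain ⟨t, ⟨htT, ht⟩, huniq⟩ := hT ⟨r⁻¹ * g, hrg⟩
  have htA : (t : G)⁻¹ * (r⁻¹ * g) ∈ A := (QuotientGroup.eq.mp ht :)
  refine ⟨r * t, ⟨⟨_, Set.mem_univ _, t, htT, rfl⟩, ?_⟩, ?_⟩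
  · rw [QuotientGroup.eq]
    simpa [mul_assoc] using htA
  · rintro _ ⟨⟨q, -, s, hsT, rfl⟩, hs⟩
    have hsA : (s : G)⁻¹ * (q.out⁻¹ * g) ∈ A := by
      simpa [mul_assoc] using QuotientGroup.eq.mp hs
    have hq : q = QuotientGroup.mk g := by
      rw [← QuotientGroup.out_eq' q, QuotientGroup.eq]
      simpa using P.mul_mem s.2 (hAP hsA)
    subst hq
    rw [huniq s ⟨hsT, QuotientGroup.eq.mpr hsA⟩]

/-- Subgroups `A₁, …, Aₙ` of a finite abelian group `G` have a common transversal in `G`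
if and only if they have a common transversal in the product subgroup `A₁A₂⋯Aₙ = ⨆ i, Aᵢ`. -/
theorem common_transversal_iff_in_product
    {G : Type*} [CommGroup G] [Fintype G] {n : ℕ} (A : Fin n → Subgroup G) :
    (∃ T : Set G, ∀ i, IsTransversal (A i) T) ↔
      (∃ T : Set ↥(⨆ i, A i), ∀ i, IsTransversal ((A i).subgroupOf (⨆ i, A i)) T) :=
  ⟨fun ⟨_, hT⟩ => ⟨_, fun i => (hT i).preimage_subtype (le_iSup A i)⟩,
    fun ⟨_, hT⟩ => ⟨_, fun i => (hT i).image2_out_mul (le_iSup A i)⟩⟩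
end

section
/- Let G be a finite abelian group with |G| = p₁^{a₁} ⋯ p_r^{a_r} (pᵢ distinct primes), and let A be a subgroup of G that has a complement in G. Then the map sending a complement H of A in G to the tuple (H ∩ G_{p₁}, …, H ∩ G_{p_r}) is a bijection from the set of complements of A in G onto the product over i of the sets of complements of A_{pᵢ} = A ∩ G_{pᵢ} in G_{pᵢ}. -/
/-- Idempotents modulo a product of pairwise coprime numbers. -/
theorem exists_modEq_single_of_pairwise_coprime {r : ℕ} (q : Fin r → ℕ)
    (hq : Pairwise (Function.onFun Nat.Coprime q)) :
    ∃ c : Fin r → ℕ, (∀ i, c i ≡ 1 [MOD q i]) ∧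
      ∀ i j, i ≠ j → c i ≡ 0 [MOD q j] := by
  have key : ∀ i, ∃ c : ℕ, c ≡ 1 [MOD q i] ∧ c ≡ 0 [MOD ∏ j ∈ Finset.univ.erase i, q j] := by
    intro i
    have hc : Nat.Coprime (q i) (∏ j ∈ Finset.univ.erase i, q j) :=
      Nat.Coprime.prod_right fun j hj => hq (Finset.ne_of_mem_erase hj).symm
    exact ⟨_, (Nat.chineseRemainder hc 1 0).2⟩
  choose c hc1 hc0 using key
  exact ⟨c, hc1, fun i j hij => (hc0 i).of_dvd
    (Finset.dvd_prod_of_mem q (Finset.mem_erase.2 ⟨hij.symm, Finset.mem_univ j⟩))⟩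

/-- The projections of a finite abelian group onto its primary components. -/
theorem exists_primary_projections {G : Type*} [CommGroup G] [Finite G] {r : ℕ}
    (p : Fin r → ℕ) (a : Fin r → ℕ)
    (hp : ∀ i, (p i).Prime) (hpinj : Function.Injective p)
    (hcard : Nat.card G = ∏ i, p i ^ a i)
    (Gp : Fin r → Subgroup G)
    (hGp : ∀ i, ∀ g : G, g ∈ Gp i ↔ ∃ k : ℕ, g ^ (p i) ^ k = 1) :
    ∃ π : (i : Fin r) → G →* Gp i,
      (∀ i (H : Subgroup G), ∀ g ∈ H, (π i g : G) ∈ H) ∧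
      (∀ i (x : Gp i), π i x = x) ∧
      (∀ i j, i ≠ j → ∀ x : Gp j, π i x = 1) ∧
      ∀ g, ∏ i, (π i g : G) = g := by
  have hcop : Pairwise (Function.onFun Nat.Coprime fun i => p i ^ a i) := fun i j hij =>
    Nat.Coprime.pow _ _ ((Nat.coprime_primes (hp i) (hp j)).2 (hpinj.ne hij))
  obtain ⟨c, hc1, hc0⟩ := exists_modEq_single_of_pairwise_coprime _ hcop
  have horder : ∀ i (x : Gp i), orderOf (x : G) ∣ p i ^ a i := by
    intro i x
    obtain ⟨k, hk⟩ := (hGp i x).1 x.2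
    have h1 : orderOf (x : G) ∣ p i ^ k := orderOf_dvd_of_pow_eq_one hk
    have h2 : orderOf (x : G) ∣ p i ^ a i * ∏ j ∈ Finset.univ.erase i, p j ^ a j := by
      rw [Finset.mul_prod_erase _ (fun j => p j ^ a j) (Finset.mem_univ i), ← hcard]
      exact orderOf_dvd_natCard _
    refine Nat.Coprime.dvd_of_dvd_mul_right (Nat.Coprime.coprime_dvd_left h1 ?_) h2
    exact Nat.Coprime.prod_right fun j hj => Nat.Coprime.pow _ _
      ((Nat.coprime_primes (hp i) (hp j)).2 (hpinj.ne (Finset.ne_of_mem_erase hj).symm))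
  have hmem : ∀ i (g : G), g ^ c i ∈ Gp i := by
    intro i g
    refine (hGp i _).2 ⟨a i, ?_⟩
    rw [← pow_mul, ← orderOf_dvd_iff_pow_eq_one]
    refine (orderOf_dvd_natCard g).trans ?_
    rw [hcard, ← Finset.mul_prod_erase _ _ (Finset.mem_univ i), mul_comm]
    refine mul_dvd_mul_right (Finset.prod_dvd_of_isRelPrime ?_ ?_) _
    · exact fun j _ k _ hjk => Nat.coprime_iff_isRelPrime.1 (hcop hjk)
    · exact fun j hj => (Nat.modEq_zero_iff_dvd).1 (hc0 i j (Finset.ne_of_mem_erase hj).symm)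
  refine ⟨fun i => (powMonoidHom (c i)).codRestrict (Gp i) (hmem i),
    fun i H g hg => H.pow_mem hg _, fun i x => Subtype.ext ?_,
    fun i j hij x => Subtype.ext ?_, fun g => ?_⟩
  · change (x : G) ^ c i = x
    simpa using pow_eq_pow_iff_modEq.2 ((hc1 i).of_dvd (horder i x))
  · change (x : G) ^ c i = 1
    simpa using pow_eq_pow_iff_modEq.2 ((hc0 i j hij).of_dvd (horder j x))
  · change ∏ i, g ^ c i = g
    rw [Finset.prod_pow_eq_pow_sum]
    have hsum : ∑ i, c i ≡ 1 [MOD Nat.card G] := by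
      rw [hcard, Nat.modEq_iff_dvd]
      push_cast
      refine Finset.prod_dvd_of_coprime ?_ ?_
      · intro j _ k _ hjk
        have := Nat.isCoprime_iff_coprime.2 (hcop hjk)
        push_cast at this
        exact this
      · intro j _
        rw [← Finset.add_sum_erase _ _ (Finset.mem_univ j), ← sub_sub]
        refine dvd_sub ?_ (Finset.dvd_sum fun i hi => ?_)
        · simpa using Nat.modEq_iff_dvd.1 (hc1 j)
        · exact_mod_cast (Nat.modEq_zero_iff_dvd).1 (hc0 i j (Finset.ne_of_mem_erase hi))
    simpa using pow_eq_pow_iff_modEq.2 (hsum.of_dvd (orderOf_dvd_natCard g))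

theorem isComplementOf_iff {G : Type*} [CommGroup G] {H A : Subgroup G} :
    IsComplementOf H A ↔
      (∀ g, ∃ x ∈ A, ∃ y ∈ H, x * y = g) ∧ ∀ g ∈ A, g ∈ H → g = 1 := by
  simp only [IsComplementOf, eq_top_iff, eq_bot_iff, SetLike.le_def, Subgroup.mem_sup,
    Subgroup.mem_inf, Subgroup.mem_bot, Subgroup.mem_top, true_implies, and_imp]

/-- Let `G` be a finite abelian group with `|G| = p₁^{a₁} ⋯ p_r^{a_r}` (the `pᵢ` distinct
primes) and let `A ≤ G` have a complement in `G`.  Writing `G_{pᵢ}` for the (unique) Sylow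
`pᵢ`-subgroup of `G` (the subgroup of elements of `pᵢ`-power order) and
`A_{pᵢ} = A ∩ G_{pᵢ}`, the map `H ↦ (H ∩ G_{p₁}, …, H ∩ G_{p_r})` is a bijection from the
set of complements of `A` in `G` onto the product of the sets of complements of
`A_{pᵢ}` in `G_{pᵢ}`. -/
theorem complements_bijection_sylow
    {G : Type*} [CommGroup G] [Fintype G] {r : ℕ}
    (p : Fin r → ℕ) (a : Fin r → ℕ)
    (hp : ∀ i, (p i).Prime) (hpinj : Function.Injective p) (ha : ∀ i, 0 < a i)
    (hcard : Nat.card G = ∏ i, p i ^ a i)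
    (Gp : Fin r → Subgroup G)
    (hGp : ∀ i, ∀ g : G, g ∈ Gp i ↔ ∃ k : ℕ, g ^ (p i) ^ k = 1)
    (A : Subgroup G) (hA : ∃ H : Subgroup G, IsComplementOf H A) :
    Set.BijOn (fun (H : Subgroup G) => fun i => (H ⊓ Gp i).subgroupOf (Gp i))
      {H : Subgroup G | IsComplementOf H A}
      {K : (i : Fin r) → Subgroup ↥(Gp i) |
        ∀ i, IsComplementOf (K i) ((A ⊓ Gp i).subgroupOf (Gp i))} := by
  obtain ⟨π, hπmem, hπself, hπne, hπprod⟩ :=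
    exists_primary_projections p a hp hpinj hcard Gp hGp
  refine ⟨fun H hH i => ?_, fun H _ H' _ hHH' => ?_, fun K hK => ?_⟩
  · obtain ⟨hsup, hinf⟩ := isComplementOf_iff.1 hH
    refine isComplementOf_iff.2 ⟨fun g => ?_, fun g hgA hgH => ?_⟩
    · obtain ⟨x, hx, y, hy, hxy⟩ := hsup g
      refine ⟨π i x, ?_, π i y, ?_, ?_⟩
      · exact Subgroup.mem_subgroupOf.2 ⟨hπmem i A x hx, (π i x).2⟩
      · exact Subgroup.mem_subgroupOf.2 ⟨hπmem i H y hy, (π i y).2⟩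
      · rw [← map_mul, hxy, hπself]
    · exact Subtype.ext (hinf g (Subgroup.mem_subgroupOf.1 hgA).1
        (Subgroup.mem_subgroupOf.1 hgH).1)
  · have key : ∀ H₁ H₂ : Subgroup G,
        (∀ i, (H₁ ⊓ Gp i).subgroupOf (Gp i) = (H₂ ⊓ Gp i).subgroupOf (Gp i)) → H₁ ≤ H₂ := by
      intro H₁ H₂ h g hg
      rw [← hπprod g]
      refine Subgroup.prod_mem _ fun i _ => ?_
      have hi : π i g ∈ (H₁ ⊓ Gp i).subgroupOf (Gp i) :=
        Subgroup.mem_subgroupOf.2 ⟨hπmem i H₁ g hg, (π i g).2⟩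
      rw [h i] at hi
      exact (Subgroup.mem_subgroupOf.1 hi).1
    exact le_antisymm (key H H' (congrFun hHH')) (key H' H fun i => (congrFun hHH' i).symm)
  · have hmem : ∀ i (x : Gp i), (x : G) ∈ ⨅ j, (K j).comap (π j) ↔ x ∈ K i := by
      intro i x
      simp only [Subgroup.mem_iInf, Subgroup.mem_comap]
      refine ⟨fun h => hπself i x ▸ h i, fun h j => ?_⟩
      by_cases hji : j = i
      · subst hji
        rwa [hπself]
      · rw [hπne j i hji]
        exact one_mem _
    refine ⟨⨅ i, (K i).comap (π i), isComplementOf_iff.2 ⟨fun g => ?_, fun g hgA hgH => ?_⟩, ?_⟩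
    · choose x hx y hy hxy using fun i => (isComplementOf_iff.1 (hK i)).1 (π i g)
      refine ⟨∏ i, (x i : G), Subgroup.prod_mem _ fun i _ => (Subgroup.mem_subgroupOf.1 (hx i)).1,
        ∏ i, (y i : G), Subgroup.prod_mem _ fun i _ => (hmem i (y i)).2 (hy i), ?_⟩
      rw [← Finset.prod_mul_distrib, ← hπprod g]
      exact Finset.prod_congr rfl fun i _ => congrArg Subtype.val (hxy i)
    · rw [← hπprod g]
      refine Finset.prod_eq_one fun i _ => congrArg Subtype.val
        ((isComplementOf_iff.1 (hK i)).2 (π i g) ?_ ?_)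
      · exact Subgroup.mem_subgroupOf.2 ⟨hπmem i A g hgA, (π i g).2⟩
      · exact Subgroup.mem_iInf.1 hgH i
    · funext i
      ext x
      exact Subgroup.mem_subgroupOf.trans ((and_iff_left x.2).trans (hmem i x))
end

section
/- Let G be a finite abelian group and A₁, …, Aₙ subgroups of G. Then A₁, …, Aₙ have a common complement in G if and only if for every prime p dividing |G| the Sylow p-subgroups A₁ ∩ G_p, …, Aₙ ∩ G_p have a common complement in G_p. -/
/-- An exponent whose power map is a projection of a finite commutative group onto its
`p`-primary part. -/
theorem exists_pow_projection (G : Type*) [CommGroup G] [Fintype G] {p : ℕ} (hp : p.Prime)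
    (hd : p ∣ Nat.card G) :
    ∃ e : ℕ, ¬ p ∣ e ∧ (∀ g : G, ∃ k : ℕ, (g ^ e) ^ p ^ k = 1) ∧
      ∀ (g : G) (k : ℕ), g ^ p ^ k = 1 → g ^ e = g := by
  have hN : Nat.card G ≠ 0 := Nat.card_pos.ne'
  obtain ⟨a, m, hpm, hN'⟩ := Nat.exists_eq_pow_mul_and_not_dvd hN p hp.ne_one
  have hco : Nat.Coprime p m := (Nat.Prime.coprime_iff_not_dvd hp).2 hpm
  have ha : a ≠ 0 := by
    rintro rfl
    apply hpm
    rwa [hN', pow_zero, one_mul] at hd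
  obtain ⟨e, he1, he0⟩ := Nat.chineseRemainder (hco.pow_left a) 1 0
  refine ⟨e, fun hpe => ?_, fun g => ⟨a, ?_⟩, fun g k hg => ?_⟩
  · have h1 : e ≡ 1 [MOD p] := he1.of_dvd (dvd_pow_self p ha)
    exact hp.one_lt.ne' (Nat.dvd_one.1 ((h1.dvd_iff dvd_rfl).1 hpe))
  · obtain ⟨c, rfl⟩ := (Nat.modEq_zero_iff_dvd).1 he0
    rw [← pow_mul, show m * c * p ^ a = Nat.card G * c by rw [hN']; ring, pow_mul,
      pow_card_eq_one', one_pow]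
  · obtain ⟨j, -, hj⟩ := (Nat.dvd_prime_pow hp).1 (orderOf_dvd_of_pow_eq_one hg)
    have hdvd : orderOf g ∣ p ^ a := by
      have h := orderOf_dvd_natCard g
      rw [hN'] at h
      refine Nat.Coprime.dvd_of_dvd_mul_right ?_ h
      rw [hj]
      exact hco.pow_left j
    simpa using pow_eq_pow_iff_modEq.2 (he1.of_dvd hdvd)

theorem eq_one_of_forall_prime_exists_pow_eq_one {Q : Type*} [Group Q] {x : Q} {N : ℕ}
    (hx : x ^ N = 1)
    (h : ∀ p : ℕ, p.Prime → p ∣ N → ∃ e : ℕ, ¬ p ∣ e ∧ x ^ e = 1) : x = 1 := by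
  by_contra hne
  obtain ⟨p, hp, hpo⟩ := Nat.exists_prime_and_dvd (mt orderOf_eq_one_iff.1 hne)
  obtain ⟨e, hpe, hxe⟩ := h p hp (hpo.trans (orderOf_dvd_of_pow_eq_one hx))
  exact hpe (hpo.trans (orderOf_dvd_of_pow_eq_one hxe))

/-- Subgroups `A₁, …, Aₙ` of a finite abelian group `G` have a common complement in `G`
if and only if for every prime `p` dividing `|G|` the Sylow `p`-subgroups
`A₁ ∩ G_p, …, Aₙ ∩ G_p` have a common complement in the Sylow `p`-subgroup `G_p` of `G`. -/
theorem common_complement_iff_sylow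
    {G : Type*} [CommGroup G] [Fintype G] {n : ℕ} (A : Fin n → Subgroup G)
    (Gp : ℕ → Subgroup G)
    (hGp : ∀ p : ℕ, p.Prime → ∀ g : G, g ∈ Gp p ↔ ∃ k : ℕ, g ^ p ^ k = 1) :
    (∃ H : Subgroup G, ∀ i, IsComplementOf H (A i)) ↔
      (∀ p : ℕ, p.Prime → p ∣ Nat.card G →
        ∃ K : Subgroup ↥(Gp p), ∀ i, IsComplementOf K ((A i ⊓ Gp p).subgroupOf (Gp p))) := by
  choose e hpe heGp hefix using fun (p : ℕ) (hp : p.Prime) (hd : p ∣ Nat.card G) =>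
    exists_pow_projection G hp hd
  constructor
  · rintro ⟨H, hH⟩ p hp hd
    refine ⟨H.subgroupOf (Gp p), fun i => ⟨?_, ?_⟩⟩
    · rw [eq_top_iff]
      rintro ⟨g, hg⟩ -
      obtain ⟨k, hk⟩ := (hGp p hp g).1 hg
      obtain ⟨a, ha, b, hb, hab⟩ := Subgroup.mem_sup.1 ((hH i).1 ▸ Subgroup.mem_top g)
      have hmem (x : G) : x ^ e p hp hd ∈ Gp p := (hGp p hp _).2 (heGp p hp hd x)
      refine Subgroup.mem_sup.2 ⟨⟨_, hmem a⟩, ⟨pow_mem ha _, hmem a⟩, ⟨_, hmem b⟩,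
        pow_mem hb _, Subtype.ext ?_⟩
      change a ^ e p hp hd * b ^ e p hp hd = g
      rw [← mul_pow, hab, hefix p hp hd g k hk]
    · rw [eq_bot_iff]
      rintro ⟨g, hg⟩ ⟨⟨hA, -⟩, hH'⟩
      have h1 : g ∈ A i ⊓ H := ⟨hA, hH'⟩
      rw [(hH i).2, Subgroup.mem_bot] at h1
      exact Subtype.ext h1
  · intro h
    choose K hK using h
    let H : Subgroup G := ⨅ (p : ℕ) (hp : p.Prime) (hd : p ∣ Nat.card G),
      ((K p hp hd).map (Gp p).subtype).comap (powMonoidHom (e p hp hd))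
    have hmemH (g : G) : g ∈ H ↔ ∀ (p : ℕ) (hp : p.Prime) (hd : p ∣ Nat.card G),
        g ^ e p hp hd ∈ (K p hp hd).map (Gp p).subtype := by
      simp only [H, Subgroup.mem_iInf, Subgroup.mem_comap, powMonoidHom_apply]
    have hKH (p : ℕ) (hp : p.Prime) (hd : p ∣ Nat.card G) (x : Gp p) (hx : x ∈ K p hp hd) :
        (x : G) ∈ H := by
      obtain ⟨k, hk⟩ := (hGp p hp x).1 x.2
      refine (hmemH _).2 fun q hq hdq => ?_
      by_cases hpq : p = q
      · subst hpq
        rw [hefix p hp hd x k hk]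
        exact Subgroup.mem_map_of_mem _ hx
      · obtain ⟨l, hl⟩ := heGp q hq hdq x
        have hk' : ((x : G) ^ e q hq hdq) ^ p ^ k = 1 := by
          rw [pow_right_comm, hk, one_pow]
        have h1 : (x : G) ^ e q hq hdq = 1 := by
          rw [← orderOf_eq_one_iff]
          exact Nat.eq_one_of_dvd_coprimes (((Nat.coprime_primes hp hq).2 hpq).pow k l)
            (orderOf_dvd_of_pow_eq_one hk') (orderOf_dvd_of_pow_eq_one hl)
        rw [h1]
        exact one_mem _
    refine ⟨H, fun i => ⟨?_, ?_⟩⟩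
    · rw [eq_top_iff]
      rintro g -
      rw [← QuotientGroup.eq_one_iff]
      refine eq_one_of_forall_prime_exists_pow_eq_one (N := Nat.card G) ?_
        fun p hp hd => ⟨e p hp hd, hpe p hp hd, ?_⟩
      · rw [← QuotientGroup.mk_pow, pow_card_eq_one', QuotientGroup.mk_one]
      · rw [← QuotientGroup.mk_pow, QuotientGroup.eq_one_iff]
        have hmem : g ^ e p hp hd ∈ Gp p := (hGp p hp _).2 (heGp p hp hd g)
        obtain ⟨a, ha, b, hb, hab⟩ := Subgroup.mem_sup.1
          ((hK p hp hd i).1 ▸ Subgroup.mem_top (⟨_, hmem⟩ : Gp p))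
        exact Subgroup.mem_sup.2 ⟨a, ha.1, b, hKH p hp hd b hb, congrArg Subtype.val hab⟩
    · rw [eq_bot_iff]
      rintro g ⟨hA, hH⟩
      rw [Subgroup.mem_bot]
      refine eq_one_of_forall_prime_exists_pow_eq_one (pow_card_eq_one' (G := G))
        fun p hp hd => ⟨e p hp hd, hpe p hp hd, ?_⟩
      obtain ⟨x, hx, hxg⟩ := Subgroup.mem_map.1 ((hmemH g).1 hH p hp hd)
      have hxg' : (x : G) = g ^ e p hp hd := hxg
      have h1 : x ∈ (A i ⊓ Gp p).subgroupOf (Gp p) ⊓ K p hp hd :=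
        ⟨⟨by simpa [hxg'] using pow_mem hA (e p hp hd), x.2⟩, hx⟩
      rw [(hK p hp hd i).2, Subgroup.mem_bot] at h1
      rw [← hxg', h1, Subgroup.coe_one]
end

section
/- Let G be a finite abelian group that is the internal direct product G = G₁ × … × Gₙ of cyclic subgroups Gᵢ of prime-power order (a primary decomposition). Then a subgroup A ≤ G has a complement in G if and only if there exists a subset I ⊆ {1, …, n} such that the projection π_I : G → ⨯_{i∈I} Gᵢ restricts to an isomorphism from A onto ⨯_{i∈I} Gᵢ. -/
/-- An element of a finite group is a generator as soon as its order is the order of the group. -/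
theorem exists_zpow_eq_of_orderOf_eq_card {C : Type*} [Group C] [Finite C] {x : C}
    (hx : orderOf x = Nat.card C) (y : C) : ∃ m : ℤ, x ^ m = y := by
  have h : Subgroup.zpowers x = ⊤ :=
    Subgroup.eq_top_of_card_eq _ (by rw [Nat.card_zpowers, hx])
  exact Subgroup.mem_zpowers_iff.1 (h ▸ Subgroup.mem_top y)

/-- In a commutative group of prime-power order, the elements that do not generate are closed under
multiplication. -/
theorem orderOf_eq_card_or_of_mul {C : Type*} [CommGroup C] (hC : IsPrimePow (Nat.card C))
    {x y : C} (h : orderOf (x * y) = Nat.card C) :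
    orderOf x = Nat.card C ∨ orderOf y = Nat.card C := by
  obtain ⟨p, k, hp, hk, hcard⟩ := hC
  replace hp := hp.nat_prime
  obtain ⟨l, rfl⟩ : ∃ l, k = l + 1 := ⟨k - 1, by omega⟩
  have key : ∀ z : C, orderOf z ≠ Nat.card C → z ^ p ^ l = 1 := fun z hz ↦ by
    obtain ⟨r, hr, hr'⟩ := (Nat.dvd_prime_pow hp).1 (hcard ▸ orderOf_dvd_natCard z)
    have hrl : r ≤ l := by
      by_contra! hlt
      exact hz (by rw [hr', ← hcard, show r = l + 1 by omega])
    exact orderOf_dvd_iff_pow_eq_one.1 (hr' ▸ pow_dvd_pow p hrl)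
  by_contra! hne
  have h1 : (x * y) ^ p ^ l = 1 := by rw [mul_pow, key x hne.1, key y hne.2, one_mul]
  have h2 := orderOf_dvd_of_pow_eq_one h1
  rw [h, ← hcard, Nat.pow_dvd_pow_iff_le_right hp.one_lt] at h2
  omega

theorem orderOf_one_ne_card {C : Type*} [Group C] (hC : IsPrimePow (Nat.card C)) :
    orderOf (1 : C) ≠ Nat.card C := by
  rw [orderOf_one]
  exact hC.one_lt.ne

theorem exists_orderOf_eq_card_of_prod {C κ : Type*} [CommGroup C] (hC : IsPrimePow (Nat.card C))
    (s : Finset κ) (f : κ → C) (h : orderOf (∏ i ∈ s, f i) = Nat.card C) :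
    ∃ i ∈ s, orderOf (f i) = Nat.card C := by
  by_contra! hne
  exact Finset.prod_induction f (fun x ↦ orderOf x ≠ Nat.card C)
    (fun x y hx hy hxy ↦ (orderOf_eq_card_or_of_mul hC hxy).elim hx hy)
    (orderOf_one_ne_card hC) hne h

/-- If `z` maps to a generator of a nontrivial group, then `z` generates its cyclic group of
prime-power order. -/
theorem orderOf_eq_card_of_map {M C : Type*} [CommGroup M] [IsCyclic M] [Group C] [Finite C]
    (hM : IsPrimePow (Nat.card M)) (hC : IsPrimePow (Nat.card C)) (c : M →* C) {z : M}
    (hz : orderOf (c z) = Nat.card C) : orderOf z = Nat.card M := by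
  have : Finite M := Nat.finite_of_card_ne_zero hM.ne_zero
  obtain ⟨g, hg⟩ := IsCyclic.exists_ofOrder_eq_natCard (α := M)
  obtain ⟨t, ht⟩ := exists_zpow_eq_of_orderOf_eq_card hz (c g)
  have hprod : orderOf (z ^ t * (g * (z ^ t)⁻¹)) = Nat.card M := by
    rw [mul_comm g, mul_inv_cancel_left, hg]
  rcases orderOf_eq_card_or_of_mul hM hprod with h | h
  · exact Nat.dvd_antisymm (orderOf_dvd_natCard z) (h ▸ orderOf_dvd_of_mem_zpowers ⟨t, rfl⟩)
  · exfalso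
    obtain ⟨m, hm⟩ := exists_zpow_eq_of_orderOf_eq_card h z
    apply orderOf_one_ne_card hC
    rw [← hz, ← hm, map_zpow, map_mul, map_inv, map_zpow, ht, mul_inv_cancel, one_zpow]

theorem isPrimePow_card_of_pos {p e : ℕ} (hp : p.Prime) (he : e ≠ 0) :
    IsPrimePow (Nat.card (Multiplicative (ZMod (p ^ e)))) := by
  rw [Nat.card_congr Multiplicative.toAdd, Nat.card_zmod]
  exact hp.isPrimePow.pow he

theorem exists_mulEquiv_pi_zmod_prime_pow (A : Type*) [CommGroup A] [Finite A] :
    ∃ (κ : Type) (_ : Fintype κ) (p e : κ → ℕ), (∀ k, (p k).Prime) ∧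
      Nonempty (A ≃* ((k : κ) → Multiplicative (ZMod (p k ^ e k)))) := by
  obtain ⟨κ, inst, p, hp, e, ⟨h⟩⟩ := AddCommGroup.equiv_directSum_zmod_of_finite (Additive A)
  exact ⟨κ, inst, p, e, hp, ⟨MulEquiv.toAdditive.symm <| h.trans <|
    (DirectSum.addEquivProd _).trans (MulEquiv.piMultiplicative _).toAdditiveRight⟩⟩

/-- A subgroup is complementary to the kernel of a surjection exactly when it maps bijectively. -/
theorem bijective_restrict_iff_isCompl_ker {G N : Type*} [CommGroup G] [Group N] (π : G →* N)
    (hπ : Function.Surjective π) (A : Subgroup G) :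
    Function.Bijective (π.comp A.subtype) ↔ IsCompl A π.ker := by
  constructor
  · rintro ⟨hi, hs⟩
    refine ⟨Subgroup.disjoint_def.2 fun {x} hx hx' ↦ ?_, codisjoint_iff.2 (eq_top_iff.2 ?_)⟩
    · exact congrArg Subtype.val (hi (a₁ := ⟨x, hx⟩) (a₂ := 1) (by simpa using hx'))
    · intro x _
      obtain ⟨a, ha⟩ := hs (π x)
      refine Subgroup.mem_sup.2 ⟨a, a.2, (a : G)⁻¹ * x, ?_, mul_inv_cancel_left _ _⟩
      have ha' : π a = π x := ha
      simp [MonoidHom.mem_ker, ha']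
  · intro h
    refine ⟨(injective_iff_map_eq_one _).2 fun a ha ↦ ?_, fun y ↦ ?_⟩
    · exact Subtype.ext (Subgroup.disjoint_def.1 h.disjoint a.2 ha)
    · obtain ⟨x, rfl⟩ := hπ y
      obtain ⟨a, ha, b, hb, rfl⟩ :=
        Subgroup.mem_sup.1 (h.codisjoint.eq_top ▸ Subgroup.mem_top x)
      exact ⟨⟨a, ha⟩, by simp [MonoidHom.mem_ker.1 hb]⟩

/-- A complemented subgroup of a commutative group is a retract. -/
theorem exists_retraction_of_isCompl {G : Type*} [CommGroup G] {A H : Subgroup G}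
    (h : IsCompl A H) : ∃ r : G →* A, ∀ a : A, r a = a := by
  have hb := (bijective_restrict_iff_isCompl_ker (QuotientGroup.mk' H)
    (QuotientGroup.mk'_surjective H) A).2 (by rwa [QuotientGroup.ker_mk'])
  exact ⟨(MulEquiv.ofBijective _ hb).symm.toMonoidHom.comp (QuotientGroup.mk' H),
    fun a ↦ (MulEquiv.ofBijective _ hb).symm_apply_apply a⟩

section Coordinates

variable {G ι : Type*} [CommGroup G] {M : ι → Type*} [∀ i, CommGroup (M i)]

/-- The elements whose coordinates vanish outside `J`. -/
def coordSubgroup (ψ : G ≃* ((i : ι) → M i)) (J : Finset ι) : Subgroup G where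
  carrier := {g | ∀ i ∉ J, ψ g i = 1}
  one_mem' := by simp
  mul_mem' := fun ha hb i hi ↦ by simp [ha i hi, hb i hi]
  inv_mem' := fun ha i hi ↦ by simp [ha i hi]

theorem mem_coordSubgroup {ψ : G ≃* ((i : ι) → M i)} {J : Finset ι} {g : G} :
    g ∈ coordSubgroup ψ J ↔ ∀ i ∉ J, ψ g i = 1 :=
  Iff.rfl

theorem mem_coordSubgroup_erase [DecidableEq ι] {ψ : G ≃* ((i : ι) → M i)} {J : Finset ι} {j : ι}
    {g : G} (hg : g ∈ coordSubgroup ψ J) (hj : ψ g j = 1) :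
    g ∈ coordSubgroup ψ (J.erase j) := fun i hi ↦ by
  by_cases hij : i = j
  · exact hij ▸ hj
  · exact hg i fun h ↦ hi (Finset.mem_erase.2 ⟨hij, h⟩)

/-- The exchange property: a cyclic retract of prime-power order, meeting `D` trivially through its
retraction, replaces one of the cyclic factors complementing `D`. -/
theorem exists_isCompl_sup_range_erase [Fintype ι] [DecidableEq ι] [∀ i, IsCyclic (M i)]
    (hM : ∀ i, IsPrimePow (Nat.card (M i))) (ψ : G ≃* ((i : ι) → M i))
    {C : Type*} [CommGroup C] [IsCyclic C] (hC : IsPrimePow (Nat.card C))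
    (c : G →* C) (s : C →* G) (hcs : ∀ x, c (s x) = x)
    {D : Subgroup G} (hD : D ≤ c.ker) {J : Finset ι} (hJ : IsCompl D (coordSubgroup ψ J)) :
    ∃ j ∈ J, IsCompl (D ⊔ s.range) (coordSubgroup ψ (J.erase j)) := by
  have : Finite C := Nat.finite_of_card_ne_zero hC.ne_zero
  have (i : ι) : Finite (M i) := Nat.finite_of_card_ne_zero (hM i).ne_zero
  have hle (j : ι) : coordSubgroup ψ (J.erase j) ≤ coordSubgroup ψ J :=
    fun g hg i hi ↦ hg i fun h ↦ hi (Finset.mem_of_mem_erase h)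
  obtain ⟨a, ha⟩ := IsCyclic.exists_ofOrder_eq_natCard (α := C)
  obtain ⟨t, ht, x, hx, htx⟩ :=
    Subgroup.mem_sup.1 (hJ.codisjoint.eq_top ▸ Subgroup.mem_top (s a))
  let incl (j : ι) : M j →* G := ψ.symm.toMonoidHom.comp (MonoidHom.mulSingle M j)
  have hax : ∏ j, c (incl j (ψ x j)) = a := by
    have hprod : ∏ j, incl j (ψ x j) = x := by
      rw [← ψ.symm_apply_apply x, ← Finset.univ_prod_mulSingle (ψ x), map_prod]
      simp [incl]
    rw [← map_prod, hprod, ← hcs a, ← htx, map_mul, MonoidHom.mem_ker.1 (hD ht), one_mul]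
  obtain ⟨j, -, hj⟩ := exists_orderOf_eq_card_of_prod hC _ _ (hax.symm ▸ ha)
  have hjJ : j ∈ J := by
    by_contra hjJ
    rw [hx j hjJ, map_one, map_one] at hj
    exact orderOf_one_ne_card hC hj
  have hgen := orderOf_eq_card_of_map (hM j) hC (c.comp (incl j)) hj
  refine ⟨j, hjJ, Subgroup.disjoint_def.2 fun {y} hy hy' ↦ ?_,
    codisjoint_iff.2 (eq_top_iff.2 ?_)⟩
  · obtain ⟨d, hd, _, ⟨b, rfl⟩, rfl⟩ := Subgroup.mem_sup.1 hy
    obtain ⟨m, rfl⟩ := exists_zpow_eq_of_orderOf_eq_card ha b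
    have hdx : d * s (a ^ m) = d * t ^ m * x ^ m := by
      rw [map_zpow, ← htx, mul_zpow, mul_assoc]
    have hone : d * t ^ m = 1 := by
      refine Subgroup.disjoint_def.1 hJ.disjoint (mul_mem hd (zpow_mem ht m)) ?_
      rw [eq_mul_inv_of_mul_eq hdx.symm]
      exact mul_mem (hle j hy') (inv_mem (zpow_mem hx m))
    have hxm : ψ x j ^ m = 1 := by
      have := hy' j (Finset.notMem_erase j J)
      rwa [hdx, hone, one_mul, map_zpow, Pi.pow_apply] at this
    have ham : a ^ m = 1 := by
      rw [← orderOf_dvd_iff_zpow_eq_one, ha, ← hj, orderOf_dvd_iff_zpow_eq_one, ← map_zpow,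
        ← map_zpow, hxm, map_one, map_one]
    rw [ham, map_one, mul_one] at hy' ⊢
    exact Subgroup.disjoint_def.1 hJ.disjoint hd (hle j hy')
  · rw [← hJ.codisjoint.eq_top]
    refine sup_le (le_sup_left.trans le_sup_left) fun y hy ↦ ?_
    obtain ⟨m, hm⟩ := exists_zpow_eq_of_orderOf_eq_card hgen (ψ y j)
    have hxmem : x ∈ D ⊔ s.range := by
      rw [eq_inv_mul_of_mul_eq htx]
      exact mul_mem (inv_mem (Subgroup.mem_sup_left ht)) (Subgroup.mem_sup_right ⟨a, rfl⟩)
    refine Subgroup.mem_sup.2 ⟨x ^ m, zpow_mem hxmem m, (x ^ m)⁻¹ * y, ?_,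
      mul_inv_cancel_left _ _⟩
    exact mem_coordSubgroup_erase (mul_mem (inv_mem (zpow_mem hx m)) hy) (by simp [hm])

/-- A complemented subgroup of a product of cyclic groups of prime-power order is complemented by a
partial product. -/
theorem exists_isCompl_coordSubgroup [Finite G] [Fintype ι] [∀ i, IsCyclic (M i)]
    (hM : ∀ i, IsPrimePow (Nat.card (M i))) (ψ : G ≃* ((i : ι) → M i))
    {A H : Subgroup G} (h : IsCompl A H) : ∃ J, IsCompl A (coordSubgroup ψ J) := by
  classical
  obtain ⟨r, hr⟩ := exists_retraction_of_isCompl h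
  obtain ⟨κ, _, p, e, hp, ⟨E⟩⟩ := exists_mulEquiv_pi_zmod_prime_pow A
  let C (k : κ) : Type := Multiplicative (ZMod (p k ^ e k))
  let c (k : κ) : G →* C k := (Pi.evalMonoidHom C k).comp (E.toMonoidHom.comp r)
  let s (k : κ) : C k →* G :=
    A.subtype.comp (E.symm.toMonoidHom.comp (MonoidHom.mulSingle C k))
  have hcs (k l : κ) (x : C l) : c k (s l x) = Pi.mulSingle (M := C) l x k := by
    simp [c, s, hr]
  have hA : ⨆ k ∈ Finset.univ, (s k).range = A := by
    refine le_antisymm (iSup₂_le fun k _ ↦ ?_) fun a ha ↦ ?_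
    · rintro _ ⟨x, rfl⟩
      exact SetLike.coe_mem _
    · have hprod : ∏ k, s k (E ⟨a, ha⟩ k) = a := by
        have h1 : ∏ k, E.symm (Pi.mulSingle (M := C) k (E ⟨a, ha⟩ k)) = ⟨a, ha⟩ := by
          rw [← map_prod, Finset.univ_prod_mulSingle, E.symm_apply_apply]
        simpa [s] using congrArg A.subtype h1
      rw [← hprod]
      exact prod_mem fun k hk ↦ Subgroup.mem_iSup_of_mem k (Subgroup.mem_iSup_of_mem hk ⟨_, rfl⟩)
  have key (T : Finset κ) : ∃ J, IsCompl (⨆ k ∈ T, (s k).range) (coordSubgroup ψ J) := by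
    induction T using Finset.induction_on with
    | empty =>
      refine ⟨Finset.univ, ?_⟩
      have : coordSubgroup ψ Finset.univ = ⊤ := eq_top_iff.2 fun g _ i hi ↦ by simp at hi
      simpa [this] using isCompl_bot_top
    | insert k T hk ih =>
      obtain ⟨J, hJ⟩ := ih
      rw [Finset.iSup_insert, sup_comm]
      by_cases he : e k = 0
      · have : Subsingleton (C k) := by
          simp only [C, he, pow_zero]
          exact inferInstanceAs (Subsingleton (ZMod 1))
        have hbot : (s k).range = ⊥ := by
          rw [eq_bot_iff]
          rintro _ ⟨x, rfl⟩
          rw [Subsingleton.elim x 1, map_one]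
          exact one_mem _
        exact ⟨J, by rwa [hbot, sup_bot_eq]⟩
      · have : IsCyclic (C k) := inferInstanceAs (IsCyclic (Multiplicative (ZMod _)))
        obtain ⟨j, -, hj⟩ := exists_isCompl_sup_range_erase hM ψ (isPrimePow_card_of_pos (hp k) he)
          (c k) (s k) (fun x ↦ by rw [hcs, Pi.mulSingle_eq_same])
          (iSup₂_le fun l hl ↦ by
            rintro _ ⟨x, rfl⟩
            rw [MonoidHom.mem_ker, hcs, Pi.mulSingle_eq_of_ne]
            exact fun hkl ↦ hk (hkl ▸ hl)) hJ
        exact ⟨_, hj⟩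
  obtain ⟨J, hJ⟩ := key Finset.univ
  exact ⟨J, hA ▸ hJ⟩

/-- A partial projection is bijective on `A` exactly when the complementary partial product is a
complement of `A`. -/
theorem bijective_proj_iff_isCompl [Fintype ι] [DecidableEq ι] (ψ : G ≃* ((i : ι) → M i))
    (A : Subgroup G) (I : Finset ι) :
    Function.Bijective (fun (a : A) (i : I) ↦ ψ (a : G) i.1) ↔
      IsCompl A (coordSubgroup ψ Iᶜ) := by
  let π : G →* ((i : I) → M i.1) := MonoidHom.pi fun i ↦ (Pi.evalMonoidHom M i.1).comp ψ.toMonoidHom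
  have hπ : Function.Surjective π := fun y ↦
    ⟨ψ.symm fun i ↦ if hi : i ∈ I then y ⟨i, hi⟩ else 1, by ext i; simp [π]⟩
  have hker : π.ker = coordSubgroup ψ Iᶜ := by
    ext g
    simp [π, MonoidHom.mem_ker, mem_coordSubgroup, funext_iff]
  rw [← hker, ← bijective_restrict_iff_isCompl_ker π hπ]
  rfl

end Coordinates

/-- Let `G = G₁ × … × Gₙ` be a primary decomposition of the finite abelian group `G`,
i.e. `G` is the internal direct product of cyclic subgroups `Gᵢ` of prime-power order
(witnessed by the multiplication map `φ : Π i, Gᵢ ≃* G` being an isomorphism).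
Then `A ≤ G` has a complement in `G` if and only if there is a subset `I ⊆ {1, …, n}` such
that the projection `π_I` onto `⨯_{i ∈ I} Gᵢ` restricts to an isomorphism (i.e. a bijection)
from `A` onto `⨯_{i ∈ I} Gᵢ`. -/
theorem complemented_iff_projection_iso
    {G : Type*} [CommGroup G] [Fintype G] {n : ℕ}
    (Gs : Fin n → Subgroup G) (hcyc : ∀ i, IsCyclic ↥(Gs i))
    (hpp : ∀ i, IsPrimePow (Nat.card (Gs i)))
    (φ : ((i : Fin n) → ↥(Gs i)) ≃* G)
    (hφ : ∀ x : (i : Fin n) → ↥(Gs i), φ x = ∏ i, ((x i : G)))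
    (A : Subgroup G) :
    (∃ H : Subgroup G, IsComplementOf H A) ↔
      ∃ I : Finset (Fin n),
        Function.Bijective (fun (a : ↥A) => fun (i : I) => (φ.symm (a : G)) i.1) := by
  classical
  simp_rw [bijective_proj_iff_isCompl φ.symm A]
  constructor
  · rintro ⟨H, hsup, hinf⟩
    obtain ⟨J, hJ⟩ := exists_isCompl_coordSubgroup hpp φ.symm
      ⟨disjoint_iff.2 hinf, codisjoint_iff.2 hsup⟩
    exact ⟨Jᶜ, by rwa [compl_compl]⟩
  · rintro ⟨I, hI⟩
    exact ⟨_, hI.sup_eq_top, hI.inf_eq_bot⟩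
end

section
/- Let G be a finite abelian p-group and let A₁, …, A_t be cyclic subgroups of G of the same order, each having a complement in G. If the set {Ω(A₁), …, Ω(A_t)} contains at most p distinct subgroups, then A₁, …, A_t have a common complement in G. -/
/-- `Ω(A)`: the subgroup generated by the elements of `A` of order dividing `p`. -/
def Omega {G : Type*} [Group G] (p : ℕ) (A : Subgroup G) : Subgroup G :=
  Subgroup.closure {g : G | g ∈ A ∧ g ^ p = 1}

/-- A finite `p`-group is not the union of at most `p` proper subgroups. -/
theorem IsPGroup.exists_notMem_of_card_le {X : Type*} [Group X] [Finite X] {p : ℕ}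
    (hp : p.Prime) (hX : IsPGroup p X) (S : Finset (Subgroup X)) (hS : ∀ K ∈ S, K ≠ ⊤)
    (hcard : S.card ≤ p) : ∃ x : X, ∀ K ∈ S, x ∉ K := by
  classical
  have : Fact p.Prime := ⟨hp⟩
  have := Fintype.ofFinite X
  by_contra! hcov
  have hle (K : Subgroup X) (hK : K ∈ S) : p * Nat.card K ≤ Nat.card X := by
    obtain ⟨n, hn⟩ := hX.index K
    have hn0 : n ≠ 0 := by
      rintro rfl
      exact hS K hK (Subgroup.index_eq_one.mp (by simpa using hn))
    rw [← K.index_mul_card, hn]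
    exact Nat.mul_le_mul_right _ (Nat.le_self_pow hn0 p)
  have hsub : (Finset.univ.erase (1 : X)) ⊆
      S.biUnion fun K => (Finset.univ.filter (· ∈ K)).erase 1 := by
    intro x hx
    obtain ⟨K, hK, hxK⟩ := hcov x
    simp only [Finset.mem_biUnion, Finset.mem_erase, Finset.mem_filter, Finset.mem_univ, true_and]
    exact ⟨K, hK, (Finset.mem_erase.mp hx).1, hxK⟩
  have hK1 (K : Subgroup X) :
      ((Finset.univ.filter (· ∈ K)).erase 1).card = Nat.card K - 1 := by
    rw [Finset.card_erase_of_mem (by simp [K.one_mem]), Nat.card_eq_fintype_card,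
      Fintype.card_subtype]
  have hbound : p * (Nat.card X - 1) ≤ p * (Nat.card X - p) := by
    calc p * (Nat.card X - 1)
        ≤ p * ∑ K ∈ S, (Nat.card K - 1) := by
          refine Nat.mul_le_mul_left _ ?_
          have := (Finset.card_le_card hsub).trans Finset.card_biUnion_le
          simpa [hK1, Finset.card_erase_of_mem] using this
      _ = ∑ K ∈ S, (p * Nat.card K - p) := by
          simp [Finset.mul_sum, Nat.mul_sub]
      _ ≤ S.card * (Nat.card X - p) := by
          rw [← smul_eq_mul]
          exact Finset.sum_le_card_nsmul _ _ _ fun K hK => Nat.sub_le_sub_right (hle K hK) p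
      _ ≤ p * (Nat.card X - p) := Nat.mul_le_mul_right _ hcard
  have h1 := Nat.le_of_mul_le_mul_left hbound hp.pos
  obtain ⟨K, hK, -⟩ := hcov 1
  have h2 : p ≤ Nat.card X :=
    (Nat.le_mul_of_pos_right p Nat.card_pos).trans (hle K hK)
  have := hp.two_le
  omega

/-- In a cyclic group, a subgroup containing an element of prime order `p` contains
every element of order dividing `p`. -/
theorem IsCyclic.mem_zpowers_of_pow_eq_one {C : Type*} [Group C] [Finite C] [IsCyclic C] {p : ℕ}
    (hp : p.Prime) {y g : C} (hy : orderOf y = p) (hg : g ^ p = 1) :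
    g ∈ Subgroup.zpowers y := by
  classical
  have := Fintype.ofFinite C
  have hsub : Finset.univ.filter (· ∈ Subgroup.zpowers y) ⊆
      Finset.univ.filter fun a : C => a ^ p = 1 := by
    intro a ha
    simp only [Finset.mem_filter, Finset.mem_univ, true_and] at ha ⊢
    obtain ⟨k, rfl⟩ := ha
    rw [← zpow_natCast, ← zpow_mul, mul_comm, zpow_mul, zpow_natCast, ← hy, pow_orderOf_eq_one,
      one_zpow]
  have hcard : (Finset.univ.filter (· ∈ Subgroup.zpowers y)).card = p := by
    rw [← hy, ← Nat.card_zpowers, Nat.card_eq_fintype_card, Fintype.card_subtype]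
  have heq := Finset.eq_of_subset_of_card_le hsub
    (by rw [hcard]; exact IsCyclic.card_pow_eq_one_le hp.pos)
  have hmem : g ∈ Finset.univ.filter (· ∈ Subgroup.zpowers y) := by
    rw [heq]; simpa using hg
  simpa using hmem

/-- A subgroup meeting a cyclic `p`-subgroup `A` nontrivially contains `Ω(A)`. -/
theorem Omega_le_of_mem {G : Type*} [Group G] [Finite G] {p : ℕ} (hp : p.Prime)
    (hG : IsPGroup p G) {A K : Subgroup G} (hA : IsCyclic A) {x : G} (hxA : x ∈ A) (hxK : x ∈ K)
    (hx : x ≠ 1) : Omega p A ≤ K := by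
  have : Fact p.Prime := ⟨hp⟩
  obtain ⟨n, hn⟩ := IsPGroup.iff_orderOf.mp hG x
  have hpdvd : p ∣ orderOf x := by
    rw [hn]
    refine dvd_pow_self p ?_
    rintro rfl
    exact hx (orderOf_eq_one_iff.mp (by simpa using hn))
  have hy : orderOf (x ^ (orderOf x / p)) = p :=
    orderOf_pow_orderOf_div (orderOf_pos x).ne' hpdvd
  refine (Subgroup.closure_le K).mpr ?_
  rintro g ⟨hgA, hg⟩
  have hmem := IsCyclic.mem_zpowers_of_pow_eq_one (C := A) hp
    (y := ⟨x ^ (orderOf x / p), A.pow_mem hxA _⟩) (g := ⟨g, hgA⟩)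
    (by rw [Subgroup.orderOf_mk, hy]) (by ext; simpa using hg)
  obtain ⟨k, hk⟩ := hmem
  have hk' : (x ^ (orderOf x / p)) ^ k = g := congrArg Subtype.val hk
  rw [← hk']
  exact K.zpow_mem (K.pow_mem hxK _) k

theorem exists_mem_Omega_ne_one {G : Type*} [Group G] [Finite G] {p : ℕ} (hp : p.Prime)
    (hG : IsPGroup p G) {A : Subgroup G} (hA : A ≠ ⊥) : ∃ x ∈ A, x ∈ Omega p A ∧ x ≠ 1 := by
  have : Fact p.Prime := ⟨hp⟩
  have : Nontrivial A := (Subgroup.nontrivial_iff_ne_bot A).mpr hA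
  obtain ⟨n, hn0, hn⟩ := (hG.to_subgroup A).nontrivial_iff_card.mp this
  obtain ⟨x, hx⟩ := exists_prime_orderOf_dvd_card' (G := A) p (hn ▸ dvd_pow_self p hn0.ne')
  refine ⟨x, x.2, Subgroup.subset_closure ⟨x.2, ?_⟩, ?_⟩
  · have := pow_orderOf_eq_one x
    rw [hx] at this
    exact congrArg Subtype.val this
  · intro h
    have : x = 1 := Subtype.ext h
    rw [this, orderOf_one] at hx
    exact hp.one_lt.ne hx

/-- A complemented subgroup `A` admits a homomorphism `G →* A` that is injective on `A`. -/
theorem IsComplementOf.exists_hom_injOn {G : Type*} [CommGroup G] {H A : Subgroup G}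
    (h : IsComplementOf H A) : ∃ f : G →* A, ∀ x ∈ A, f x = 1 → x = 1 := by
  have hinj : Function.Injective ((QuotientGroup.mk' H).comp A.subtype) := by
    rw [injective_iff_map_eq_one]
    intro a ha
    have haH : (a : G) ∈ H := (QuotientGroup.eq_one_iff _).mp ha
    have : (a : G) ∈ A ⊓ H := ⟨a.2, haH⟩
    rw [h.2] at this
    exact Subtype.ext (Subgroup.mem_bot.mp this)
  have hsurj : Function.Surjective ((QuotientGroup.mk' H).comp A.subtype) := by
    intro q
    obtain ⟨g, rfl⟩ := QuotientGroup.mk'_surjective H q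
    obtain ⟨a, ha, b, hb, rfl⟩ := Subgroup.mem_sup.mp (h.1 ▸ Subgroup.mem_top g : g ∈ A ⊔ H)
    refine ⟨⟨a, ha⟩, ?_⟩
    have hb1 : QuotientGroup.mk' H b = 1 := (QuotientGroup.eq_one_iff _).mpr hb
    rw [map_mul, hb1, mul_one]
    rfl
  let e := MulEquiv.ofBijective _ ⟨hinj, hsurj⟩
  refine ⟨e.symm.toMonoidHom.comp (QuotientGroup.mk' H), fun x hx h1 => ?_⟩
  have h2 : QuotientGroup.mk' H x = 1 := e.symm.map_eq_one_iff.mp h1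
  exact congrArg Subtype.val (hinj (a₁ := ⟨x, hx⟩) (a₂ := 1) (h2.trans (map_one _).symm))

/-- The kernel of a homomorphism onto a group of the order of `A` that is injective on `A`
is a complement of `A`. -/
theorem isComplementOf_ker {G C : Type*} [CommGroup G] [CommGroup C] [Finite C] {A : Subgroup G}
    (f : G →* C) (hcard : Nat.card A = Nat.card C) (hf : ∀ x ∈ A, f x = 1 → x = 1) :
    IsComplementOf f.ker A := by
  have hinj : Function.Injective (f.comp A.subtype) := by
    rw [injective_iff_map_eq_one]
    exact fun a ha => Subtype.ext (hf a a.2 ha)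
  have hbij := hinj.bijective_of_nat_card_le hcard.ge
  refine ⟨eq_top_iff.mpr fun g _ => ?_, eq_bot_iff.mpr fun x hx => hf x hx.1 hx.2⟩
  obtain ⟨a, ha⟩ := hbij.2 (f g)
  have ha' : f a = f g := ha
  refine Subgroup.mem_sup.mpr ⟨a, a.2, (a : G)⁻¹ * g, ?_, mul_inv_cancel_left _ _⟩
  simp [MonoidHom.mem_ker, ha']

/-- The homomorphisms to `C` that vanish on `K`. -/
def homAnnihilator {G : Type*} [Group G] (C : Type*) [CommGroup C] (K : Subgroup G) :
    Subgroup (G →* C) where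
  carrier := {f | ∀ x ∈ K, f x = 1}
  one_mem' _ _ := rfl
  mul_mem' hf hg x hx := by simp [hf x hx, hg x hx]
  inv_mem' hf x hx := by simp [hf x hx]

/-- Let `A₁, …, A_t` be complemented cyclic subgroups of the same order of a finite
abelian `p`-group `G`.  If there are at most `p` distinct subgroups among
`Ω(A₁), …, Ω(A_t)`, then `A₁, …, A_t` have a common complement in `G`. -/
theorem common_complement_of_few_omegas
    {G : Type*} [CommGroup G] [Fintype G] {p : ℕ} (hp : p.Prime) (hG : IsPGroup p G)
    {t : ℕ} (A : Fin t → Subgroup G)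
    (hcyc : ∀ i, IsCyclic ↥(A i))
    (hcard : ∀ i j, Nat.card (A i) = Nat.card (A j))
    (hcompl : ∀ i, ∃ H : Subgroup G, IsComplementOf H (A i))
    (homega : (Set.range fun i => Omega p (A i)).ncard ≤ p) :
    ∃ H : Subgroup G, ∀ i, IsComplementOf H (A i) := by
  classical
  have : Fact p.Prime := ⟨hp⟩
  rcases isEmpty_or_nonempty (Fin t) with ht | ⟨⟨i₀⟩⟩
  · exact ⟨⊤, fun i => isEmptyElim i⟩
  by_cases hbot : A i₀ = ⊥
  · have hA (i : Fin t) : A i = ⊥ :=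
      Subgroup.card_eq_one.mp ((hcard i i₀).trans (Subgroup.card_eq_one.mpr hbot))
    exact ⟨⊤, fun i => ⟨sup_top_eq _, by rw [hA i, bot_inf_eq]⟩⟩
  have hA (i : Fin t) : A i ≠ ⊥ := fun h =>
    hbot (Subgroup.card_eq_one.mp ((hcard i₀ i).trans (Subgroup.card_eq_one.mpr h)))
  have hX : IsPGroup p (G →* A i₀) := by
    obtain ⟨n, hn⟩ := IsPGroup.iff_card.mp (hG.to_subgroup (A i₀))
    refine fun f => ⟨n, MonoidHom.ext fun x => ?_⟩
    rw [MonoidHom.pow_apply, ← hn, pow_card_eq_one', MonoidHom.one_apply]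
  have : Finite (G →* A i₀) := DFunLike.finite _
  have hfin : (Set.range fun i => Omega p (A i)).Finite := Set.finite_range _
  obtain ⟨f, hf⟩ := hX.exists_notMem_of_card_le hp
    (hfin.toFinset.image (homAnnihilator (A i₀))) (by
      simp only [Finset.mem_image, Set.Finite.mem_toFinset, Set.mem_range]
      rintro _ ⟨_, ⟨i, rfl⟩, rfl⟩ htop
      obtain ⟨H, hH⟩ := hcompl i
      obtain ⟨f, hf⟩ := hH.exists_hom_injOn
      obtain ⟨x, hxA, hxO, hx⟩ := exists_mem_Omega_ne_one hp hG (hA i)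
      have := hcyc i
      have := hcyc i₀
      let e : A i ≃* A i₀ := mulEquivOfCyclicCardEq (hcard i i₀)
      have hmem : e.toMonoidHom.comp f ∈ homAnnihilator (A i₀) (Omega p (A i)) :=
        htop ▸ Subgroup.mem_top _
      exact hx (hf x hxA (e.map_eq_one_iff.mp (hmem x hxO))))
    (Finset.card_image_le.trans (by rwa [← Set.ncard_eq_toFinset_card _ hfin]))
  refine ⟨f.ker, fun i => isComplementOf_ker f (hcard i i₀) fun x hxA hfx => ?_⟩
  by_contra hx
  exact hf _ (Finset.mem_image_of_mem _ (hfin.mem_toFinset.mpr ⟨i, rfl⟩))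
    fun y hy => Omega_le_of_mem (K := f.ker) hp hG (hcyc i) hxA hfx hx hy
end

section
/- Let G be a finite abelian group and suppose a subgroup A ≅ C_{n₁} × … × C_{n_k} (a direct product of cyclic groups of orders n₁, …, n_k) has a complement in G. Then the number of complements of A in G equals |Γ_{n₁}(G/A)| ⋯ |Γ_{n_k}(G/A)|. -/
/-- `Γ_n(H)`: the subgroup generated by the elements `g` of `H` with `g ^ n = 1`. -/
def Gamma {H : Type*} [Group H] (n : ℕ) : Subgroup H :=
  Subgroup.closure {g : H | g ^ n = 1}

lemma mem_Gamma_iff {H : Type*} [CommGroup H] {n : ℕ} {x : H} : x ∈ Gamma n ↔ x ^ n = 1 := by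
  have h : Gamma (H := H) n = (powMonoidHom n : H →* H).ker :=
    Subgroup.closure_eq (powMonoidHom n : H →* H).ker
  rw [h, MonoidHom.mem_ker, powMonoidHom_apply]

/-- Homomorphisms into the `n`-th roots of unity are the `n`-torsion characters. -/
def homRootsOfUnityEquiv (Q M : Type*) [CommGroup Q] [CommMonoid M] (n : ℕ) :
    (Q →* rootsOfUnity n M) ≃ {φ : Q →* Mˣ // φ ^ n = 1} where
  toFun f := ⟨(rootsOfUnity n M).subtype.comp f, by
    ext1 x
    exact (f x).2⟩
  invFun φ := φ.1.codRestrict (rootsOfUnity n M) fun x => DFunLike.congr_fun φ.2 x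
  left_inv _ := rfl
  right_inv _ := rfl

/-- The number of homomorphisms from a finite abelian group to `C_n` is the order of its
`n`-torsion subgroup. -/
lemma card_hom_zmod_eq_card_Gamma {Q : Type*} [CommGroup Q] [Finite Q] {n : ℕ} (hn : 0 < n) :
    Nat.card (Q →* Multiplicative (ZMod n)) = Nat.card (Gamma (H := Q) n) := by
  have : NeZero n := ⟨hn.ne'⟩
  have hexp : NeZero ((Monoid.exponent Q : ℕ) : ℂ) :=
    ⟨Nat.cast_ne_zero.mpr Monoid.exponent_ne_zero_of_finite⟩
  let e : Multiplicative (ZMod n) ≃* rootsOfUnity n ℂ := mulEquivOfCyclicCardEq (by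
    rw [Complex.card_rootsOfUnity, Nat.card_congr Multiplicative.toAdd, Nat.card_zmod])
  obtain ⟨d⟩ := CommGroup.monoidHom_mulEquiv_of_hasEnoughRootsOfUnity Q ℂ
  refine Nat.card_congr <| e.monoidHomCongrRightEquiv.trans <|
    (homRootsOfUnityEquiv Q ℂ n).trans <| d.toEquiv.subtypeEquiv fun φ => ?_
  rw [mem_Gamma_iff]
  change φ ^ n = 1 ↔ d φ ^ n = 1
  rw [← map_pow, map_eq_one_iff d d.injective]

/-- A homomorphism into a product is a family of homomorphisms into the factors. -/
def homPiEquiv {ι Q : Type*} {M : ι → Type*} [MulOneClass Q] [∀ i, MulOneClass (M i)] :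
    (Q →* ∀ i, M i) ≃ ∀ i, Q →* M i where
  toFun f i := (Pi.evalMonoidHom M i).comp f
  invFun := MonoidHom.pi
  left_inv _ := rfl
  right_inv _ := rfl

/-- The retractions of a group onto a subgroup. -/
abbrev Retraction {G : Type*} [Group G] (A : Subgroup G) :=
  {r : G →* A // ∀ a : A, r a = a}

lemma isComplementOf_ker_s11 {G : Type*} [Group G] {A : Subgroup G} (r : Retraction A) :
    IsComplementOf r.1.ker A := by
  refine ⟨eq_top_iff.mpr fun g _ => ?_, eq_bot_iff.mpr fun g hg => ?_⟩
  · rw [← mul_inv_cancel_left (r.1 g : G) g]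
    refine Subgroup.mul_mem_sup (r.1 g).2 ?_
    rw [MonoidHom.mem_ker, map_mul, map_inv, r.2, inv_mul_cancel]
  · have h := r.2 ⟨g, hg.1⟩
    rw [MonoidHom.mem_ker.mp hg.2] at h
    exact (congrArg Subtype.val h).symm

lemma ker_retraction_injective {G : Type*} [Group G] {A : Subgroup G} {r s : Retraction A}
    (h : r.1.ker = s.1.ker) : r = s := by
  ext1
  ext1 g
  have hg : (r.1 g : G)⁻¹ * g ∈ s.1.ker := by
    rw [← h, MonoidHom.mem_ker, map_mul, map_inv, r.2, inv_mul_cancel]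
  rwa [MonoidHom.mem_ker, map_mul, map_inv, s.2, inv_mul_eq_one] at hg

lemma exists_retraction_ker_eq {G : Type*} [CommGroup G] {A H : Subgroup G}
    (h : IsComplementOf H A) : ∃ r : Retraction A, r.1.ker = H := by
  have hbij : Function.Bijective ((QuotientGroup.mk' H).comp A.subtype) := by
    refine ⟨(injective_iff_map_eq_one _).mpr fun a ha => ?_, fun q => ?_⟩
    · have ha' : (a : G) ∈ A ⊓ H := ⟨a.2, (QuotientGroup.eq_one_iff _).mp ha⟩
      rw [h.2] at ha'
      exact Subtype.ext ha'
    · obtain ⟨g, rfl⟩ := QuotientGroup.mk'_surjective H q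
      obtain ⟨a, ha, b, hb, rfl⟩ := Subgroup.mem_sup.mp (h.1 ▸ Subgroup.mem_top g)
      refine ⟨⟨a, ha⟩, ?_⟩
      exact QuotientGroup.eq.mpr (by simpa using hb)
  let e := MulEquiv.ofBijective _ hbij
  refine ⟨⟨(e.symm : G ⧸ H →* A).comp (QuotientGroup.mk' H), fun a => e.symm_apply_apply a⟩, ?_⟩
  ext g
  rw [MonoidHom.mem_ker]
  exact (map_eq_one_iff e.symm e.symm.injective).trans (QuotientGroup.eq_one_iff g)

/-- Complements of `A` in an abelian group correspond to retractions onto `A`. -/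
noncomputable def retractionEquivComplement {G : Type*} [CommGroup G] (A : Subgroup G) :
    Retraction A ≃ {H : Subgroup G // IsComplementOf H A} :=
  Equiv.ofBijective (fun r => ⟨r.1.ker, isComplementOf_ker_s11 r⟩)
    ⟨fun _ _ h => ker_retraction_injective (congrArg Subtype.val h), fun H =>
      (exists_retraction_ker_eq H.2).imp fun _ h => Subtype.ext h⟩

/-- A retraction onto `A` identifies the set of all retractions with `Hom(G/A, A)`. -/
def retractionEquivHom {G : Type*} [CommGroup G] {A : Subgroup G} (r₀ : Retraction A) :
    Retraction A ≃ (G ⧸ A →* A) where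
  toFun r := QuotientGroup.lift A (r.1 / r₀.1) fun a ha => by
    rw [MonoidHom.mem_ker, MonoidHom.div_apply, r.2 ⟨a, ha⟩, r₀.2 ⟨a, ha⟩, div_self']
  invFun f := ⟨f.comp (QuotientGroup.mk' A) * r₀.1, fun a => by
    have ha : ((a : G) : G ⧸ A) = 1 := (QuotientGroup.eq_one_iff _).mpr a.2
    simp [ha, r₀.2]⟩
  left_inv r := by
    ext g
    simp
  right_inv f := by
    ext g
    simp

/-- Suppose the subgroup `A ≅ C_{n₁} × … × C_{n_k}` of a finite abelian group `G` has a
complement in `G`.  Then the number of complements of `A` in `G` equals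
`|Γ_{n₁}(G/A)| ⋯ |Γ_{n_k}(G/A)|`. -/
theorem card_complements_eq_prod_gamma
    {G : Type*} [CommGroup G] [Fintype G] (A : Subgroup G)
    {k : ℕ} (n : Fin k → ℕ) (hn : ∀ i, 0 < n i)
    (hiso : Nonempty (↥A ≃* ((i : Fin k) → Multiplicative (ZMod (n i)))))
    (h : ∃ H : Subgroup G, IsComplementOf H A) :
    Nat.card {H : Subgroup G // IsComplementOf H A} =
      ∏ i, Nat.card (Gamma (H := G ⧸ A) (n i)) := by
  obtain ⟨e⟩ := hiso
  obtain ⟨H, hH⟩ := h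
  obtain ⟨r₀, -⟩ := exists_retraction_ker_eq hH
  rw [Nat.card_congr <| (retractionEquivComplement A).symm.trans <|
    (retractionEquivHom r₀).trans <| e.monoidHomCongrRightEquiv.trans homPiEquiv, Nat.card_pi]
  exact Finset.prod_congr rfl fun i _ => card_hom_zmod_eq_card_Gamma (hn i)
end

section
/- Let G = A₁ × ⋯ × A_t × B be a finite abelian group written as an internal direct product of subgroups A₁, …, A_t, B, where A₁, …, A_t are pairwise isomorphic. Then the number of common complements of A₁, …, A_t in G equals (∏_{i=2}^{t} |Iso(A₁, Aᵢ)|) · |Hom(A₁, B)|, where Iso(A₁, Aᵢ) is the set of group isomorphisms from A₁ to Aᵢ and Hom(A₁, B) the set of group homomorphisms from A₁ to B. -/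
theorem nat_card_monoidHom_le_swap (A B : Type*) [CommGroup A] [CommGroup B] [Finite A]
    [Finite B] : Nat.card (A →* B) ≤ Nat.card (B →* A) := by
  have : NeZero ((Monoid.exponent A : ℕ) : ℂ) :=
    ⟨Nat.cast_ne_zero.mpr Monoid.exponent_ne_zero_of_finite⟩
  have : NeZero ((Monoid.exponent B : ℕ) : ℂ) :=
    ⟨Nat.cast_ne_zero.mpr Monoid.exponent_ne_zero_of_finite⟩
  obtain ⟨eA⟩ := CommGroup.monoidHom_mulEquiv_of_hasEnoughRootsOfUnity A ℂ
  obtain ⟨eB⟩ := CommGroup.monoidHom_mulEquiv_of_hasEnoughRootsOfUnity B ℂ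
  have : Finite (B →* A) := DFunLike.finite _
  refine Nat.card_le_card_of_injective
    (fun f : A →* B => (eA.toMonoidHom.comp (MonoidHom.compHom' f)).comp eB.symm.toMonoidHom) ?_
  intro f g hfg
  ext a
  refine (CommGroup.forall_apply_eq_apply_iff B (M := ℂ)).mp fun χ => ?_
  have h := DFunLike.congr_fun hfg (eB χ)
  simp only [MonoidHom.comp_apply, MulEquiv.toMonoidHom_eq_coe, MonoidHom.coe_coe,
    MulEquiv.symm_apply_apply, EmbeddingLike.apply_eq_iff_eq] at h
  exact DFunLike.congr_fun h a

/-- For finite abelian groups, `|Hom(A, B)| = |Hom(B, A)|`. -/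
theorem nat_card_monoidHom_swap (A B : Type*) [CommGroup A] [CommGroup B] [Finite A]
    [Finite B] : Nat.card (A →* B) = Nat.card (B →* A) :=
  le_antisymm (nat_card_monoidHom_le_swap A B) (nat_card_monoidHom_le_swap B A)

/-- A complement of a subgroup of an abelian group is the kernel of a retraction onto it. -/
theorem IsComplementOf.exists_retraction {G : Type*} [CommGroup G] {H A : Subgroup G}
    (h : IsComplementOf H A) : ∃ π : G →* A, (∀ a : A, π a = a) ∧ π.ker = H := by
  have hbij : Function.Bijective (A.subtype.coprod H.subtype) := by
    constructor
    · rw [injective_iff_map_eq_one]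
      rintro ⟨a, b⟩ hab
      have hab' : (a : G) * b = 1 := hab
      have ha : (a : G) ∈ A ⊓ H :=
        ⟨a.2, by rw [eq_inv_of_mul_eq_one_left hab']; exact H.inv_mem b.2⟩
      rw [h.2, Subgroup.mem_bot] at ha
      rw [ha, one_mul] at hab'
      exact Prod.ext (Subtype.ext ha) (Subtype.ext hab')
    · intro x
      obtain ⟨a, ha, b, hb, rfl⟩ := Subgroup.mem_sup.mp (h.1 ▸ Subgroup.mem_top x)
      exact ⟨(⟨a, ha⟩, ⟨b, hb⟩), rfl⟩
  let e := MulEquiv.ofBijective _ hbij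
  have he (a : A) (b : H) : e.symm (a * b) = (a, b) := by
    rw [MulEquiv.symm_apply_eq]; rfl
  refine ⟨(MonoidHom.fst A H).comp e.symm.toMonoidHom, fun a => ?_, ?_⟩
  · simpa using congrArg Prod.fst (he a 1)
  · ext x
    obtain ⟨⟨a, b⟩, rfl⟩ := e.surjective x
    have hab : e (a, b) = (a : G) * b := rfl
    simp only [MonoidHom.mem_ker, MonoidHom.comp_apply, MulEquiv.toMonoidHom_eq_coe,
      MonoidHom.coe_coe, MulEquiv.symm_apply_apply, MonoidHom.coe_fst]
    constructor
    · rintro rfl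
      rw [hab, OneMemClass.coe_one, one_mul]
      exact b.2
    · intro hx
      rw [hab] at hx
      have ha : (a : G) ∈ A ⊓ H := ⟨a.2, (H.mul_mem_cancel_right b.2).mp hx⟩
      rw [h.2, Subgroup.mem_bot] at ha
      exact Subtype.ext ha

/-- If `π` is surjective, then `ker π` is a complement of `A` exactly when the
restriction of `π` to `A` is bijective. -/
theorem isComplementOf_ker_iff {G K : Type*} [CommGroup G] [CommGroup K] (π : G →* K)
    (hπ : Function.Surjective π) (A : Subgroup G) :
    IsComplementOf π.ker A ↔ Function.Bijective (π.comp A.subtype) := by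
  constructor
  · intro h
    constructor
    · rw [injective_iff_map_eq_one]
      intro a ha
      have : (a : G) ∈ A ⊓ π.ker := ⟨a.2, ha⟩
      rw [h.2, Subgroup.mem_bot] at this
      exact Subtype.ext this
    · intro k
      obtain ⟨x, rfl⟩ := hπ k
      obtain ⟨a, ha, b, hb, rfl⟩ := Subgroup.mem_sup.mp (h.1 ▸ Subgroup.mem_top x)
      refine ⟨⟨a, ha⟩, ?_⟩
      simp [MonoidHom.mem_ker.mp hb]
  · intro h
    constructor
    · rw [eq_top_iff]
      intro x _
      obtain ⟨a, ha⟩ := h.2 (π x)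
      have ha' : π a = π x := ha
      refine Subgroup.mem_sup.mpr ⟨a, a.2, (a : G)⁻¹ * x, ?_, by simp⟩
      simp [MonoidHom.mem_ker, ha']
    · rw [eq_bot_iff]
      rintro x ⟨hx, hx'⟩
      exact congrArg Subtype.val (@h.1 ⟨x, hx⟩ 1 (by simpa using hx'))

/-- Common complements of a family of subgroups correspond to retractions onto one of them that
restrict to bijections on all of them. -/
theorem nat_card_common_complements_eq_retractions {G ι : Type*} [CommGroup G]
    (A : ι → Subgroup G) (k : ι) :
    Nat.card {H : Subgroup G // ∀ i, IsComplementOf H (A i)} =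
      Nat.card {π : G →* A k // (∀ a : A k, π a = a) ∧
        ∀ i, Function.Bijective (π.comp (A i).subtype)} := by
  have hsurj (π : G →* A k) (h : ∀ a : A k, π a = a) : Function.Surjective π :=
    fun a => ⟨a, h a⟩
  symm
  refine Nat.card_congr (Equiv.ofBijective
    (fun π => ⟨π.1.ker, fun i => (isComplementOf_ker_iff _ (hsurj _ π.2.1) _).mpr (π.2.2 i)⟩)
    ⟨?_, ?_⟩)
  · rintro ⟨π, hπ, _⟩ ⟨ρ, hρ, _⟩ h
    have hker : π.ker = ρ.ker := congrArg Subtype.val h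
    refine Subtype.ext (MonoidHom.ext fun x => ?_)
    have hx : x * (π x : G)⁻¹ ∈ ρ.ker := by
      rw [← hker, MonoidHom.mem_ker, map_mul, map_inv, hπ, mul_inv_cancel]
    rw [MonoidHom.mem_ker, map_mul, map_inv, hρ, mul_inv_eq_one] at hx
    exact hx.symm
  · rintro ⟨H, hH⟩
    obtain ⟨π, hπ, rfl⟩ := (hH k).exists_retraction
    exact ⟨⟨π, hπ, fun i => (isComplementOf_ker_iff _ (hsurj _ hπ) _).mp (hH i)⟩, rfl⟩

/-- Homomorphisms out of an internal direct product are determined by arbitrary homomorphisms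
on the factors. -/
theorem bijective_restrict_internal_product {G K ι : Type*} [CommGroup G] [CommGroup K]
    [Fintype ι] (A : ι → Subgroup G) (B : Subgroup G)
    (hdp : Function.Bijective
      (fun x : ((i : ι) → A i) × B => (∏ i, (x.1 i : G)) * (x.2 : G))) :
    Function.Bijective (fun π : G →* K =>
      ((fun i => π.comp (A i).subtype, π.comp B.subtype) : ((i : ι) → A i →* K) × (B →* K))) := by
  classical
  constructor
  · intro π ρ h
    ext x
    obtain ⟨⟨a, b⟩, rfl⟩ := hdp.2 x
    have h₁ (i : ι) (y : A i) : π y = ρ y :=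
      DFunLike.congr_fun (congrFun (congrArg Prod.fst h) i) y
    have h₂ (y : B) : π y = ρ y := DFunLike.congr_fun (congrArg Prod.snd h) y
    simp [h₁, h₂]
  · rintro ⟨F, g⟩
    let m : ((i : ι) → A i) × B →* G :=
      (∏ i, (A i).subtype.comp (Pi.evalMonoidHom (fun i => A i) i)).coprod B.subtype
    have hm : (m : ((i : ι) → A i) × B → G) =
        fun x => (∏ i, (x.1 i : G)) * (x.2 : G) := by
      funext x
      simp [m, MonoidHom.finsetProd_apply]
    let e := MulEquiv.ofBijective m (hm ▸ hdp)
    let f : ((i : ι) → A i) × B →* K :=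
      (∏ i, (F i).comp (Pi.evalMonoidHom (fun i => A i) i)).coprod g
    have hf (x) : f x = (∏ i, F i (x.1 i)) * g x.2 := by
      simp [f, MonoidHom.finsetProd_apply]
    have heA (i : ι) (a : A i) : e.symm a = (Pi.mulSingle i a, 1) := by
      rw [MulEquiv.symm_apply_eq]
      change (a : G) = m _
      simp only [hm]
      rw [Finset.prod_eq_single i] <;> simp +contextual [Pi.mulSingle_eq_of_ne]
    have heB (b : B) : e.symm b = (1, b) := by
      rw [MulEquiv.symm_apply_eq]
      change (b : G) = m _
      rw [hm]
      simp
    refine ⟨f.comp e.symm.toMonoidHom, Prod.ext (funext fun i => ?_) ?_⟩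
    · ext a
      change f (e.symm a) = F i a
      rw [heA, hf, Finset.prod_eq_single i] <;> simp +contextual [Pi.mulSingle_eq_of_ne]
    · ext b
      change f (e.symm b) = g b
      rw [heB, hf]
      simp

/-- Let `G = A₁ × ⋯ × A_t × B` be a finite abelian group, written as an internal direct
product of subgroups (witnessed by bijectivity of the multiplication map), where
`A₁, …, A_t` are pairwise isomorphic.  Then the number of common complements of
`A₁, …, A_t` in `G` equals `(∏_{i=2}^{t} |Iso(A₁, Aᵢ)|) · |Hom(A₁, B)|`. -/
theorem card_common_complements_internal_product
    {G : Type*} [CommGroup G] [Fintype G] {t : ℕ} (ht : 0 < t)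
    (A : Fin t → Subgroup G) (B : Subgroup G)
    (hdp : Function.Bijective
      (fun x : ((i : Fin t) → ↥(A i)) × ↥B => (∏ i, ((x.1 i : G))) * (x.2 : G)))
    (hiso : ∀ i j, Nonempty (↥(A i) ≃* ↥(A j))) :
    Nat.card {H : Subgroup G // ∀ i, IsComplementOf H (A i)} =
      (∏ i ∈ Finset.univ.erase ⟨0, ht⟩, Nat.card (↥(A ⟨0, ht⟩) ≃* ↥(A i))) *
        Nat.card (↥(A ⟨0, ht⟩) →* ↥B) := by
  classical
  set k : Fin t := ⟨0, ht⟩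
  let P (i : Fin t) (f : A i →* A k) : Prop :=
    Function.Bijective f ∧ (i = k → ∀ a : A i, (f a : G) = a)
  have hretr : Nat.card {π : G →* A k // (∀ a : A k, π a = a) ∧
      ∀ i, Function.Bijective (π.comp (A i).subtype)} =
      Nat.card (((i : Fin t) → {f : A i →* A k // P i f}) × (B →* A k)) := by
    let E := Equiv.ofBijective _ (bijective_restrict_internal_product (K := A k) A B hdp)
    have hE (π : G →* A k) : ((∀ a : A k, π a = a) ∧
        ∀ i, Function.Bijective (π.comp (A i).subtype)) ↔ ∀ i, P i ((E π).1 i) := by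
      constructor
      · rintro ⟨h₁, h₂⟩ i
        refine ⟨h₂ i, ?_⟩
        rintro rfl a
        exact congrArg Subtype.val (h₁ a)
      · intro h
        exact ⟨fun a => Subtype.ext ((h k).2 rfl a), fun i => (h i).1⟩
    refine Nat.card_congr ((E.subtypeEquiv (q := fun y => ∀ i, P i (y.1 i)) hE).trans ?_)
    exact
      { toFun := fun x => (fun i => ⟨x.1.1 i, x.2 i⟩, x.1.2)
        invFun := fun y => ⟨(fun i => (y.1 i).1, y.2), fun i => (y.1 i).2⟩
        left_inv := fun _ => rfl
        right_inv := fun _ => rfl }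
  have hk : Nat.card {f : A k →* A k // P k f} = 1 := by
    rw [Nat.card_eq_one_iff_unique]
    refine ⟨⟨fun f g => Subtype.ext (MonoidHom.ext fun a => Subtype.ext ?_)⟩,
      ⟨⟨MonoidHom.id _, Function.bijective_id, fun _ _ => rfl⟩⟩⟩
    rw [f.2.2 rfl, g.2.2 rfl]
  have hne (i : Fin t) (hi : i ≠ k) :
      Nat.card {f : A i →* A k // P i f} = Nat.card (A k ≃* A i) := by
    refine Nat.card_congr
      { toFun := fun f => (MulEquiv.ofBijective f.1 f.2.1).symm
        invFun := fun e => ⟨e.symm.toMonoidHom, e.symm.bijective, fun h => absurd h hi⟩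
        left_inv := fun f => ?_
        right_inv := fun e => ?_ }
    · ext a
      rfl
    · apply MulEquiv.symm_bijective.injective
      ext a
      rfl
  rw [nat_card_common_complements_eq_retractions A k, hretr, Nat.card_prod, Nat.card_pi,
    ← Finset.mul_prod_erase _ _ (Finset.mem_univ k), hk, one_mul, nat_card_monoidHom_swap B (A k)]
  congr 1
  exact Finset.prod_congr rfl fun i hi => hne i (Finset.ne_of_mem_erase hi)
end

section
/- Let G = A₁ × ⋯ × A_t × B be a finite abelian group written as an internal direct product of subgroups, where A₁, …, A_t are cyclic of order n. Then the number of common complements of A₁, …, A_t in G equals φ(n)^{t−1} · |Γ_n(B)|, where φ is Euler's totient function. -/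
theorem Gamma_eq_ker_powMonoidHom {H : Type*} [CommGroup H] (n : ℕ) :
    Gamma (H := H) n = (powMonoidHom n : H →* H).ker := by
  have : {g : H | g ^ n = 1} = ((powMonoidHom n : H →* H).ker : Set H) := by
    ext; simp [MonoidHom.mem_ker]
  rw [Gamma, this, Subgroup.closure_eq]

theorem card_monoidHom_rootsOfUnity_eq_card_Gamma {B : Type*} [CommGroup B] [Finite B] (n : ℕ) :
    Nat.card (B →* rootsOfUnity n ℂ) = Nat.card (Gamma (H := B) n) := by
  have : NeZero (Monoid.exponent B) := ⟨Monoid.exponent_ne_zero_of_finite⟩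
  rw [Gamma_eq_ker_powMonoidHom, ← Subgroup.index_range, Subgroup.index,
    ← CommGroup.card_domRestrictHom_ker ℂ]
  have mem_ker (f : B →* ℂˣ) :
      f ∈ (MonoidHom.domRestrictHom (powMonoidHom n : B →* B).range ℂˣ).ker ↔
        ∀ b, f b ∈ rootsOfUnity n ℂ := by
    simp [MonoidHom.mem_ker, MonoidHom.ext_iff, mem_rootsOfUnity]
  refine Nat.card_congr
    { toFun f := ⟨(rootsOfUnity n ℂ).subtype.comp f, (mem_ker _).2 fun b ↦ (f b).2⟩
      invFun f := f.1.codRestrict _ ((mem_ker _).1 f.2)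
      left_inv f := rfl
      right_inv f := rfl }

theorem IsComplementOf.exists_ker_eq {G C : Type*} [CommGroup G] [Group C] {H A : Subgroup G}
    (h : IsComplementOf H A) (φ : A ≃* C) :
    ∃ f : G →* C, f.ker = H ∧ ∀ a : A, f a = φ a := by
  have hc : A.IsComplement' H := by
    refine Subgroup.isComplement'_of_disjoint_and_mul_eq_univ (disjoint_iff.2 h.2) ?_
    rw [← Subgroup.mul_normal, h.1, Subgroup.coe_top]
  let e := hc.QuotientMulEquiv.trans φ
  refine ⟨e.toMonoidHom.comp (QuotientGroup.mk' H), ?_, fun a ↦ ?_⟩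
  · ext x; simp
  · have : hc.QuotientMulEquiv.symm a = QuotientGroup.mk' H (a : G) := rfl
    simp only [MulEquiv.toMonoidHom_eq_coe, MonoidHom.comp_apply, ← this, MonoidHom.coe_coe, e,
      MulEquiv.trans_apply, MulEquiv.apply_symm_apply]

theorem isComplementOf_ker_iff_s13 {G C : Type*} [Group G] [Group C] {A : Subgroup G}
    {f : G →* C} (hf : Function.Surjective f) :
    IsComplementOf f.ker A ↔ Function.Bijective (f.comp A.subtype) := by
  have injective_iff : Function.Injective (f.comp A.subtype) ↔ A ⊓ f.ker = ⊥ := by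
    rw [injective_iff_map_eq_one, Subgroup.eq_bot_iff_forall]
    simp [Subgroup.mem_inf, MonoidHom.mem_ker]
  rw [IsComplementOf, Function.Bijective, injective_iff, and_comm]
  refine and_congr_right fun _ ↦ ⟨fun h c ↦ ?_, fun h ↦ eq_top_iff.2 fun x _ ↦ ?_⟩
  · obtain ⟨x, rfl⟩ := hf c
    obtain ⟨a, ha, k, hk, rfl⟩ := Subgroup.mem_sup_of_normal_right.1 (h ▸ Subgroup.mem_top x)
    exact ⟨⟨a, ha⟩, by simp [(MonoidHom.mem_ker).1 hk]⟩
  · obtain ⟨a, ha⟩ := h (f x)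
    refine Subgroup.mem_sup_of_normal_right.2 ⟨a, a.2, (a : G)⁻¹ * x, ?_, by simp⟩
    simp_all [MonoidHom.mem_ker]

/-- Homomorphisms to `C` which are bijective on every `A i` correspond to pairs of a common
complement of the `A i` and an isomorphism from a fixed `A i₀` to `C`. -/
theorem card_bijective_restrictions_eq_card_common_complements_mul {G C ι : Type*} [CommGroup G]
    [Group C] (A : ι → Subgroup G) (i₀ : ι) :
    Nat.card {f : G →* C // ∀ i, Function.Bijective (f.comp (A i).subtype)} =
      Nat.card {H : Subgroup G // ∀ i, IsComplementOf H (A i)} * Nat.card (A i₀ ≃* C) := by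
  have surj (f : G →* C) (h : Function.Bijective (f.comp (A i₀).subtype)) :
      Function.Surjective f := fun c ↦
    let ⟨a, ha⟩ := h.2 c
    ⟨a, ha⟩
  rw [← Nat.card_prod]
  refine Nat.card_congr (Equiv.ofBijective (fun f ↦
    (⟨f.1.ker, fun i ↦ (isComplementOf_ker_iff_s13 (surj f.1 (f.2 i₀))).2 (f.2 i)⟩,
      MulEquiv.ofBijective (f.1.comp (A i₀).subtype) (f.2 i₀))) ⟨?_, ?_⟩)
  · rintro ⟨f, hf⟩ ⟨g, hg⟩ h
    obtain ⟨hker, hres⟩ := Prod.ext_iff.1 h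
    replace hker : f.ker = g.ker := congrArg Subtype.val hker
    have hc := ((isComplementOf_ker_iff_s13 (surj f (hf i₀))).2 (hf i₀)).1
    refine Subtype.ext (MonoidHom.ext fun x ↦ ?_)
    obtain ⟨a, ha, k, hk, rfl⟩ := Subgroup.mem_sup_of_normal_right.1 (hc ▸ Subgroup.mem_top x)
    have hk' : g k = 1 := by rwa [hker] at hk
    have hfg : f a = g a := DFunLike.congr_fun hres (⟨a, ha⟩ : A i₀)
    simp [MonoidHom.mem_ker.1 hk, hk', hfg]
  · rintro ⟨⟨H, hH⟩, φ⟩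
    obtain ⟨f, rfl, hf⟩ := (hH i₀).exists_ker_eq φ
    have hs : Function.Surjective f := fun c ↦ ⟨φ.symm c, by simp [hf]⟩
    exact ⟨⟨f, fun i ↦ (isComplementOf_ker_iff_s13 hs).1 (hH i)⟩,
      Prod.ext rfl (MulEquiv.ext hf)⟩

theorem card_bijective_restrictions_of_internal_product {G C ι : Type*} [CommGroup G]
    [CommGroup C] [Fintype ι] (A : ι → Subgroup G) (B : Subgroup G)
    (hdp : Function.Bijective
      (fun x : ((i : ι) → A i) × B => (∏ i, ((x.1 i : G))) * (x.2 : G))) :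
    Nat.card {f : G →* C // ∀ i, Function.Bijective (f.comp (A i).subtype)} =
      (∏ i, Nat.card (A i ≃* C)) * Nat.card (B →* C) := by
  classical
  let e : ((i : ι) → A i) × B ≃* G :=
    { Equiv.ofBijective _ hdp with
      map_mul' x y := by simp [Finset.prod_mul_distrib, mul_mul_mul_comm] }
  have he (x) : e x = (∏ i, (x.1 i : G)) * x.2 := rfl
  rw [← Nat.card_pi, ← Nat.card_prod]
  refine Nat.card_congr (Equiv.ofBijective (fun f ↦
    (fun i ↦ MulEquiv.ofBijective (f.1.comp (A i).subtype) (f.2 i), f.1.comp B.subtype)) ⟨?_, ?_⟩)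
  · rintro ⟨f, hf⟩ ⟨g, hg⟩ h
    obtain ⟨hA, hB⟩ := Prod.ext_iff.1 h
    refine Subtype.ext (MonoidHom.ext fun x ↦ ?_)
    obtain ⟨⟨a, b⟩, rfl⟩ := e.surjective x
    have hAi (i) : f (a i) = g (a i) := DFunLike.congr_fun (congrFun hA i) (a i)
    have hBb : f b = g b := DFunLike.congr_fun hB b
    simp [he, map_prod, hAi, hBb]
  · rintro ⟨φ, ψ⟩
    let f : G →* C := ((∏ i, (φ i).toMonoidHom.comp (Pi.evalMonoidHom _ i)).coprod ψ).comp
      e.symm.toMonoidHom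
    have hf (x) : f (e x) = (∏ i, φ i (x.1 i)) * ψ x.2 := by
      simp [f, MonoidHom.finsetProd_apply]
    have hfA (i) (a : A i) : f a = φ i a := by
      have hea : e (Pi.mulSingle i a, 1) = a := by
        rw [he, Fintype.prod_eq_single i fun j hj ↦ by simp [hj]]
        simp
      rw [← hea, hf, Fintype.prod_eq_single i fun j hj ↦ by simp [hj]]
      simp
    have hfB (b : B) : f b = ψ b := by
      have heb : e (1, b) = b := by simp [he]
      rw [← heb, hf]
      simp
    refine ⟨⟨f, fun i ↦ ?_⟩, Prod.ext (funext fun i ↦ MulEquiv.ext (hfA i)) (MonoidHom.ext hfB)⟩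
    convert (φ i).bijective using 1
    exact funext (hfA i)

theorem IsCyclic.card_mulEquiv {A C : Type*} [Group A] [Group C] [Finite A] [IsCyclic A]
    [IsCyclic C] (h : Nat.card A = Nat.card C) :
    Nat.card (A ≃* C) = Nat.totient (Nat.card A) := by
  let e : A ≃* C := mulEquivOfCyclicCardEq h
  rw [← IsCyclic.card_mulAut]
  exact Nat.card_congr
    { toFun φ := φ.trans e.symm
      invFun φ := MulEquiv.trans φ e
      left_inv φ := by ext; simp
      right_inv φ := by ext; simp }


/-- Let `G = A₁ × ⋯ × A_t × B` be a finite abelian group, written as an internal direct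
product of subgroups (witnessed by bijectivity of the multiplication map), where
`A₁, …, A_t` are cyclic of order `n`.  Then the number of common complements of
`A₁, …, A_t` in `G` equals `φ(n)^{t−1} · |Γ_n(B)|`. -/
theorem card_common_complements_cyclic_internal_product
    {G : Type*} [CommGroup G] [Fintype G] {t : ℕ} (ht : 0 < t)
    (A : Fin t → Subgroup G) (B : Subgroup G) (n : ℕ)
    (hdp : Function.Bijective
      (fun x : ((i : Fin t) → ↥(A i)) × ↥B => (∏ i, ((x.1 i : G))) * (x.2 : G)))
    (hcyc : ∀ i, IsCyclic ↥(A i)) (hord : ∀ i, Nat.card (A i) = n) :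
    Nat.card {H : Subgroup G // ∀ i, IsComplementOf H (A i)} =
      Nat.totient n ^ (t - 1) * Nat.card (Gamma (H := ↥B) n) := by
  let i₀ : Fin t := ⟨0, ht⟩
  have : NeZero n := ⟨hord i₀ ▸ Nat.card_pos.ne'⟩
  have hC : Nat.card (rootsOfUnity n ℂ) = n := HasEnoughRootsOfUnity.natCard_rootsOfUnity ℂ n
  have card_mulEquiv (i) : Nat.card (A i ≃* rootsOfUnity n ℂ) = Nat.totient n := by
    rw [IsCyclic.card_mulEquiv ((hord i).trans hC.symm), hord]
  have count := (card_bijective_restrictions_eq_card_common_complements_mul A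
    (C := rootsOfUnity n ℂ) i₀).symm.trans
      (card_bijective_restrictions_of_internal_product A B hdp)
  simp only [card_mulEquiv, Finset.prod_const, Finset.card_univ, Fintype.card_fin,
    card_monoidHom_rootsOfUnity_eq_card_Gamma] at count
  refine Nat.eq_of_mul_eq_mul_right (Nat.totient_pos.2 (NeZero.pos n)) (count.trans ?_)
  rw [mul_right_comm, pow_sub_one_mul ht.ne']
end

section
/- Let G be a finite abelian p-group and let A, B be cyclic subgroups of G of maximal order (i.e., |A| = |B| equals the exponent of G). Then the number of common complements of A and B in G equals |G : A| if A ∩ B > 1, and equals φ(|G : A|) if A ∩ B = 1, where φ is Euler's totient function. -/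
open Subgroup

/-- In a finite cyclic group, an element lies in the subgroup generated by any
other element of the same order. -/
lemma IsCyclic.mem_zpowers_of_orderOf_eq {C : Type*} [CommGroup C] [IsCyclic C] [Finite C]
    {x y : C} (h : orderOf x = orderOf y) : x ∈ zpowers y := by
  have hle : zpowers y ≤ (powMonoidHom (orderOf y) : C →* C).ker := by
    rw [zpowers_le]
    simp [MonoidHom.mem_ker, pow_orderOf_eq_one]
  have heq := eq_of_le_of_card_ge hle (by
    rw [IsCyclic.card_powMonoidHom_ker, Nat.card_zpowers]
    exact Nat.gcd_le_right _ (orderOf_pos y))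
  rw [heq, MonoidHom.mem_ker, powMonoidHom_apply, ← h, pow_orderOf_eq_one]

/-- A nontrivial subgroup of a finite `p`-group contains an element of order `p`. -/
lemma IsPGroup.exists_mem_orderOf_eq {G : Type*} [Group G] [Finite G] {p : ℕ} (hp : p.Prime)
    (hG : IsPGroup p G) {K : Subgroup G} (hK : K ≠ ⊥) : ∃ x ∈ K, orderOf x = p := by
  have : Fact p.Prime := ⟨hp⟩
  have : Nontrivial K := (nontrivial_iff_ne_bot K).2 hK
  obtain ⟨n, hn, hc⟩ := (hG.to_subgroup K).nontrivial_iff_card.1 this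
  obtain ⟨x, hx⟩ := exists_prime_orderOf_dvd_card' (G := K) p (hc ▸ dvd_pow_self p hn.ne')
  exact ⟨x, x.2, by rw [orderOf_coe, hx]⟩

/-- A subgroup meets a cyclic subgroup `B` of a finite abelian `p`-group trivially iff it omits
a given element of order `p` of `B`. -/
lemma IsPGroup.inf_eq_bot_iff_of_isCyclic {G : Type*} [CommGroup G] [Finite G] {p : ℕ}
    (hp : p.Prime) (hG : IsPGroup p G) {B : Subgroup G} [IsCyclic B] {b : G} (hb : b ∈ B)
    (hbp : orderOf b = p) (K : Subgroup G) : B ⊓ K = ⊥ ↔ b ∉ K := by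
  constructor
  · intro h hbK
    have hb1 : b ∈ B ⊓ K := ⟨hb, hbK⟩
    rw [h, mem_bot] at hb1
    rw [hb1, orderOf_one] at hbp
    exact hp.one_lt.ne hbp
  · contrapose!
    intro h
    obtain ⟨x, hx, hxp⟩ := hG.exists_mem_orderOf_eq hp h
    have hmem : (⟨b, hb⟩ : B) ∈ zpowers (⟨x, hx.1⟩ : B) :=
      IsCyclic.mem_zpowers_of_orderOf_eq (by rw [orderOf_mk, orderOf_mk, hbp, hxp])
    obtain ⟨k, hk⟩ := mem_zpowers_iff.1 hmem
    have hk' : x ^ k = b := congrArg Subtype.val hk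
    exact hk' ▸ K.zpow_mem hx.2 k

section Characters

variable {G : Type*} [CommGroup G] [Finite G]

/-- Characters of a finite abelian group extend along injective homomorphisms. -/
lemma surjective_comp_of_injective {C : Type*} [CommGroup C] [Finite C] {i : C →* G}
    (hi : Function.Injective i) :
    Function.Surjective (MonoidHom.compHom' i : (G →* ℂˣ) →* (C →* ℂˣ)) := by
  intro θ
  have : NeZero (Monoid.exponent G) := ⟨Monoid.exponent_ne_zero_of_finite⟩
  obtain ⟨χ, hχ⟩ := MonoidHom.domRestrict_surjective (M := ℂ) i.range
    (θ.comp (MonoidHom.ofInjective hi).symm.toMonoidHom)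
  refine ⟨χ, ?_⟩
  ext c
  have := DFunLike.congr_fun hχ (MonoidHom.ofInjective hi c)
  simpa [MonoidHom.ofInjective_apply] using congrArg Units.val this

/-- The number of extensions of a character along an injective homomorphism. -/
lemma card_extensions_mul_card {C : Type*} [CommGroup C] [Finite C] {i : C →* G}
    (hi : Function.Injective i) (θ : C →* ℂˣ) :
    Nat.card {χ : G →* ℂˣ // χ.comp i = θ} * Nat.card C = Nat.card G := by
  have : NeZero (Monoid.exponent G) := ⟨Monoid.exponent_ne_zero_of_finite⟩
  have : NeZero (Monoid.exponent C) := ⟨Monoid.exponent_ne_zero_of_finite⟩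
  have hs := surjective_comp_of_injective hi
  have hfib : Nat.card {χ : G →* ℂˣ // χ.comp i = θ} =
      Nat.card (MonoidHom.compHom' i : (G →* ℂˣ) →* (C →* ℂˣ)).ker :=
    Nat.card_congr (MonoidHom.fiberEquivKerOfSurjective hs θ)
  rw [hfib, ← CommGroup.card_monoidHom_of_hasEnoughRootsOfUnity C ℂ,
    ← CommGroup.card_monoidHom_of_hasEnoughRootsOfUnity G ℂ, mul_comm,
    ← Nat.card_congr (QuotientGroup.quotientKerEquivOfSurjective _ hs).toEquiv,
    ← card_eq_card_quotient_mul_card_subgroup]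

/-- The kernel of a character is a complement of a subgroup of order the exponent as soon as it
meets that subgroup trivially. -/
lemma isComplementOf_ker_iff_s14 {A : Subgroup G} (hA : Nat.card A = Monoid.exponent G)
    (χ : G →* ℂˣ) : IsComplementOf χ.ker A ↔ A ⊓ χ.ker = ⊥ := by
  refine ⟨fun h ↦ h.2, fun h ↦ ⟨?_, h⟩⟩
  have : NeZero (Monoid.exponent G) := ⟨Monoid.exponent_ne_zero_of_finite⟩
  have hmem (g : G) : χ g ∈ rootsOfUnity (Monoid.exponent G) ℂ := by
    rw [mem_rootsOfUnity, ← map_pow, Monoid.pow_exponent_eq_one, map_one]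
  let f : A → rootsOfUnity (Monoid.exponent G) ℂ := fun a ↦ ⟨χ a, hmem a⟩
  have hinj : Function.Injective f := by
    intro a b hab
    have hab' : χ a = χ b := congrArg Subtype.val hab
    have : (a : G)⁻¹ * b ∈ A ⊓ χ.ker :=
      ⟨A.mul_mem (A.inv_mem a.2) b.2, by simp [hab']⟩
    rw [h, mem_bot, inv_mul_eq_one] at this
    exact Subtype.ext this
  have hsurj : Function.Surjective f :=
    (hinj.bijective_of_nat_card_le (by
      rw [hA, Complex.card_rootsOfUnity])).2
  refine eq_top_iff.2 fun g _ ↦ ?_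
  obtain ⟨a, ha⟩ := hsurj ⟨χ g, hmem g⟩
  have ha' : χ a = χ g := congrArg Subtype.val ha
  exact mem_sup.2 ⟨a, a.2, (a : G)⁻¹ * g, by simp [MonoidHom.mem_ker, ha'], by simp⟩

/-- Taking kernels identifies the extensions of a faithful character of a subgroup `A` of order
the exponent with the complements of `A`. -/
noncomputable def extensionsEquivComplements {A : Subgroup G}
    (hA : Nat.card A = Monoid.exponent G) {θ : A →* ℂˣ} (hθ : Function.Injective θ) :
    {χ : G →* ℂˣ // χ.comp A.subtype = θ} ≃ {H : Subgroup G // IsComplementOf H A} := by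
  have key (χ : G →* ℂˣ) (hχ : χ.comp A.subtype = θ) (a : G) (ha : a ∈ A) (h1 : χ a = 1) :
      a = 1 := by
    have h2 : θ ⟨a, ha⟩ = 1 := by rw [← hχ]; exact h1
    exact congrArg Subtype.val (hθ (h2.trans (map_one θ).symm))
  refine Equiv.ofBijective (fun χ ↦ ⟨χ.1.ker, (isComplementOf_ker_iff_s14 hA χ.1).2
    (eq_bot_iff.2 fun a ha ↦ key χ.1 χ.2 a ha.1 ha.2)⟩) ⟨?_, ?_⟩
  · rintro ⟨χ, hχ⟩ ⟨ψ, hψ⟩ h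
    have hker : χ.ker = ψ.ker := congrArg Subtype.val h
    have htop : A ⊔ χ.ker = ⊤ := ((isComplementOf_ker_iff_s14 hA χ).2
      (eq_bot_iff.2 fun a ha ↦ key χ hχ a ha.1 ha.2)).1
    refine Subtype.ext (MonoidHom.ext fun g ↦ ?_)
    obtain ⟨a, ha, k, hk, rfl⟩ := mem_sup.1 (htop ▸ mem_top g : g ∈ A ⊔ χ.ker)
    have hk' : ψ k = 1 := (hker ▸ hk : k ∈ ψ.ker)
    have hak : χ a = ψ a := DFunLike.congr_fun (hχ.trans hψ.symm) ⟨a, ha⟩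
    simp only [map_mul]
    rw [hak, hk', MonoidHom.mem_ker.1 hk]
  · rintro ⟨H, hsup, hinf⟩
    have hi : Function.Injective ((QuotientGroup.mk' H).comp A.subtype) := by
      rw [injective_iff_map_eq_one]
      intro a ha
      have haH : (a : G) ∈ A ⊓ H := ⟨a.2, (QuotientGroup.eq_one_iff (a : G)).1 ha⟩
      rw [hinf, mem_bot] at haH
      exact Subtype.ext haH
    obtain ⟨χ, hχ⟩ := surjective_comp_of_injective hi θ
    have hχ' : (χ.comp (QuotientGroup.mk' H)).comp A.subtype = θ := hχ
    have hle : H ≤ (χ.comp (QuotientGroup.mk' H)).ker := fun h hh ↦ by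
      simp [MonoidHom.mem_ker, (QuotientGroup.eq_one_iff h).2 hh]
    refine ⟨⟨χ.comp (QuotientGroup.mk' H), hχ'⟩, Subtype.ext (le_antisymm (fun g hg ↦ ?_) hle)⟩
    obtain ⟨a, ha, k, hk, rfl⟩ := mem_sup.1 (hsup ▸ mem_top g : g ∈ A ⊔ H)
    have ha1 : a = 1 := key _ hχ' a ha (by
      have := (mul_mem_cancel_right (hle hk)).1 hg
      exact this)
    rwa [ha1, one_mul]

/-- A cyclic subgroup has a faithful character. -/
lemma exists_injective_character (A : Subgroup G) [IsCyclic A] :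
    ∃ θ : A →* ℂˣ, Function.Injective θ := by
  have : NeZero (Nat.card A) := ⟨Nat.card_pos.ne'⟩
  let e : A ≃* rootsOfUnity (Nat.card A) ℂ := mulEquivOfCyclicCardEq (by
    rw [Complex.card_rootsOfUnity])
  exact ⟨(rootsOfUnity (Nat.card A) ℂ).subtype.comp e.toMonoidHom,
    Subtype.val_injective.comp e.injective⟩

/-- Extensions of a character that are trivial on a subgroup `P` are the extensions to the
quotient by `P`. -/
noncomputable def extensionsQuotientEquiv {C : Type*} [CommGroup C] (i : C →* G)
    (P : Subgroup G) (θ : C →* ℂˣ) :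
    {χ : G ⧸ P →* ℂˣ // χ.comp ((QuotientGroup.mk' P).comp i) = θ} ≃
      {χ : {χ : G →* ℂˣ // χ.comp i = θ} // P ≤ χ.1.ker} where
  toFun χ := ⟨⟨χ.1.comp (QuotientGroup.mk' P), χ.2⟩, fun g hg ↦ by
    simp [MonoidHom.mem_ker, (QuotientGroup.eq_one_iff g).2 hg]⟩
  invFun χ := ⟨QuotientGroup.lift P χ.1.1 χ.2, χ.1.2⟩
  left_inv χ := Subtype.ext (by ext; rfl)
  right_inv χ := rfl

end Characters

/-- Let `A`, `B` be cyclic subgroups of maximal order (i.e. of order the exponent) of a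
finite abelian `p`-group `G`.  Then the number of common complements of `A` and `B` in `G`
equals `|G : A|` if `A ∩ B > 1`, and `φ(|G : A|)` if `A ∩ B = 1`. -/
theorem card_common_complements_two_cyclic
    {G : Type*} [CommGroup G] [Fintype G] {p : ℕ} (hp : p.Prime) (hG : IsPGroup p G)
    (A B : Subgroup G) (hA : IsCyclic ↥A) (hB : IsCyclic ↥B)
    (hAe : Nat.card A = Monoid.exponent G) (hBe : Nat.card B = Monoid.exponent G) :
    (A ⊓ B ≠ ⊥ →
      Nat.card {H : Subgroup G // IsComplementOf H A ∧ IsComplementOf H B} = A.index) ∧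
    (A ⊓ B = ⊥ →
      Nat.card {H : Subgroup G // IsComplementOf H A ∧ IsComplementOf H B} =
        Nat.totient A.index) := by
  have : Fact p.Prime := ⟨hp⟩
  obtain ⟨θ, hθ⟩ := exists_injective_character A
  let e := extensionsEquivComplements hAe hθ
  have hApos : 0 < Nat.card A := Nat.card_pos
  have htotal : Nat.card {χ : G →* ℂˣ // χ.comp A.subtype = θ} = A.index :=
    Nat.eq_of_mul_eq_mul_right hApos (by
      rw [card_extensions_mul_card A.subtype_injective, index_mul_card])
  have hcount (b : G) (hb : b ∈ B) (hbp : orderOf b = p) :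
      Nat.card {H : Subgroup G // IsComplementOf H A ∧ IsComplementOf H B} =
        Nat.card {χ : {χ : G →* ℂˣ // χ.comp A.subtype = θ} // ¬ zpowers b ≤ χ.1.ker} := by
    refine Nat.card_congr ((Equiv.subtypeSubtypeEquivSubtypeInter _ _).symm.trans
      (e.subtypeEquiv fun χ ↦ ?_).symm)
    rw [zpowers_le]
    exact (hG.inf_eq_bot_iff_of_isCyclic hp hb hbp _).symm.trans
      (isComplementOf_ker_iff_s14 hBe χ.1).symm
  refine ⟨fun hAB ↦ ?_, fun hAB ↦ ?_⟩
  · obtain ⟨b, hb, hbp⟩ := hG.exists_mem_orderOf_eq hp hAB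
    rw [hcount b hb.2 hbp, ← htotal]
    refine Nat.card_congr (Equiv.subtypeUnivEquiv fun χ ↦ ?_)
    rw [zpowers_le]
    exact (hG.inf_eq_bot_iff_of_isCyclic hp hb.1 hbp _).1 (e χ).2.2
  · by_cases hB1 : B = ⊥
    · have hexp : Monoid.exponent G = 1 := by rw [← hBe, hB1, card_bot]
      have : Subsingleton G := Monoid.exp_eq_one_iff.1 hexp
      have hA1 : A.index = 1 := by rw [Subsingleton.elim A ⊤, index_top]
      rw [hA1, Nat.totient_one, Nat.card_eq_one_iff_unique]
      exact ⟨inferInstance, ⟨⟨⊤, ⟨Subsingleton.elim _ _, Subsingleton.elim _ _⟩,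
        ⟨Subsingleton.elim _ _, Subsingleton.elim _ _⟩⟩⟩⟩
    · obtain ⟨b, hb, hbp⟩ := hG.exists_mem_orderOf_eq hp hB1
      have hi : Function.Injective ((QuotientGroup.mk' (zpowers b)).comp A.subtype) := by
        rw [injective_iff_map_eq_one]
        intro a ha
        have haB : (a : G) ∈ A ⊓ B :=
          ⟨a.2, zpowers_le.2 hb ((QuotientGroup.eq_one_iff (a : G)).1 ha)⟩
        rw [hAB, mem_bot] at haB
        exact Subtype.ext haB
      have hM := card_extensions_mul_card hi θ
      rw [Nat.card_congr (extensionsQuotientEquiv A.subtype (zpowers b) θ)] at hM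
      set M := Nat.card {χ : {χ : G →* ℂˣ // χ.comp A.subtype = θ} // zpowers b ≤ χ.1.ker}
      have hMp : M * p = A.index := by
        refine Nat.eq_of_mul_eq_mul_right hApos ?_
        rw [index_mul_card, card_eq_card_quotient_mul_card_subgroup (zpowers b), ← hM,
          Nat.card_zpowers, hbp]
        ring
      have : Finite {χ : G →* ℂˣ // χ.comp A.subtype = θ} := Finite.of_equiv _ e.symm
      have hsplit : A.index = M +
          Nat.card {χ : {χ : G →* ℂˣ // χ.comp A.subtype = θ} // ¬ zpowers b ≤ χ.1.ker} := by
        classical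
        rw [← htotal, ← Nat.card_sum]
        exact Nat.card_congr (Equiv.sumCompl _).symm
      rw [hcount b hb hbp]
      obtain ⟨n, hn⟩ := hG.index A
      obtain ⟨k, rfl⟩ : ∃ k, n = k + 1 := by
        refine Nat.exists_eq_succ_of_ne_zero fun h0 ↦ ?_
        rw [h0, pow_zero] at hn
        exact hp.one_lt.ne' (Nat.eq_one_of_mul_eq_one_left (hMp.trans hn))
      have hMk : M = p ^ k :=
        Nat.eq_of_mul_eq_mul_right hp.pos (by rw [hMp, hn, pow_succ])
      rw [hMk, hn] at hsplit
      rw [hn, Nat.totient_prime_pow_succ hp, Nat.mul_sub, mul_one, ← pow_succ]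
      omega
end

section
/- Let G be a finite abelian group and let A, B be cyclic subgroups of G of maximal order (order equal to the exponent of G) with index s = |G : A| = |G : B|. Then the number of common complements of A and B in G is at least φ(s), where φ is Euler's totient function; equivalently, the proportion of complements of A in G that are simultaneously complements of B is at least φ(s)/s. -/
/-- The preimage of a set under a surjective homomorphism is a union of cosets of the kernel. -/
theorem MonoidHom.card_preimage_of_surjective {X Y : Type*} [Group X] [Group Y]
    (f : X →* Y) (hf : Function.Surjective f) (p : Y → Prop) :
    Nat.card {x : X // p (f x)} = Nat.card {y : Y // p y} * Nat.card f.ker := by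
  rw [← Nat.card_prod]
  let E : {x : X // p (f x)} ≃ Σ y : {y : Y // p y}, {x : X // f x = y} :=
    { toFun := fun x => ⟨⟨f x, x.2⟩, ⟨x, rfl⟩⟩
      invFun := fun z => ⟨z.2.1, by rw [z.2.2]; exact z.1.2⟩
      left_inv := fun _ => rfl
      right_inv := fun z => Sigma.subtype_ext (Subtype.ext z.2.2) rfl }
  exact Nat.card_congr (E.trans ((Equiv.sigmaCongrRight fun y : {y : Y // p y} =>
    show {x : X // f x = y} ≃ f.ker from MonoidHom.fiberEquivKerOfSurjective hf y.1).trans (Equiv.sigmaEquivProd _ _)))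

theorem Nat.totient_mul_le_mul_totient (a b : ℕ) :
    Nat.totient (a * b) ≤ b * Nat.totient a := by
  induction b using Nat.recOnMul generalizing a with
  | zero => simp
  | one => simp
  | prime p hp =>
    rw [mul_comm]
    by_cases h : p ∣ a
    · exact (Nat.totient_mul_of_prime_of_dvd hp h).le
    · rw [Nat.totient_mul_of_prime_of_not_dvd hp h]
      exact Nat.mul_le_mul_right _ (Nat.sub_le p 1)
  | mul x y hx hy =>
    rw [← mul_assoc]
    calc Nat.totient (a * x * y) ≤ y * Nat.totient (a * x) := hy _
      _ ≤ y * (x * Nat.totient a) := Nat.mul_le_mul_left _ (hx a)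
      _ = x * y * Nat.totient a := by ring

/-- A coset `u μ_t` with `u ^ t` of order `m` contains at least `φ(t)` elements of
order `t * m`. -/
theorem totient_le_card_rootsOfUnity_orderOf_mul {t m : ℕ} (ht : t ≠ 0) (hm : m ≠ 0)
    (u : ℂˣ) (hu : orderOf (u ^ t) = m) :
    Nat.totient t ≤ Nat.card {ζ : rootsOfUnity t ℂ // orderOf (u * (ζ : ℂˣ)) = t * m} := by
  have : NeZero t := ⟨ht⟩
  have : NeZero m := ⟨hm⟩
  have : NeZero (t * m) := ⟨mul_ne_zero ht hm⟩
  have hd : m ∣ t * m := dvd_mul_left m t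
  obtain ⟨z₀, hz₀⟩ := HasEnoughRootsOfUnity.exists_primitiveRoot ℂ (t * m)
  obtain ⟨z, rfl⟩ := hz₀.isUnit (NeZero.ne _)
  have hz : IsPrimitiveRoot z (t * m) := IsPrimitiveRoot.coe_units_iff.mp hz₀
  have hzt : IsPrimitiveRoot (z ^ t) m := hz.pow (NeZero.pos _) rfl
  have hup : IsPrimitiveRoot (u ^ t) m := IsPrimitiveRoot.iff_orderOf.mpr hu
  obtain ⟨k, -, hkc, hk⟩ := hzt.isPrimitiveRoot_iff'.mp hup
  let f := ZMod.unitsMap hd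
  have hf : Function.Surjective f := ZMod.unitsMap_surjective hd
  let j : (ZMod m)ˣ := ZMod.unitOfCoprime k hkc
  have hpow (i : (ZMod (t * m))ˣ) (hi : f i = j) : (z ^ (i : ZMod (t * m)).val) ^ t = u ^ t := by
    rw [← hk, ← pow_mul, mul_comm, pow_mul, pow_eq_pow_iff_modEq, ← hzt.eq_orderOf,
      ← ZMod.natCast_eq_natCast_iff]
    have := congrArg Units.val hi
    simpa [f, j, ZMod.unitsMap_val, ZMod.natCast_val] using this
  let g : {i : (ZMod (t * m))ˣ // f i = j} →
      {ζ : rootsOfUnity t ℂ // orderOf (u * (ζ : ℂˣ)) = t * m} := fun i =>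
    ⟨⟨u⁻¹ * z ^ (i.1 : ZMod (t * m)).val, by
      rw [mem_rootsOfUnity, mul_pow, hpow i.1 i.2, inv_pow, inv_mul_cancel]⟩, by
      rw [mul_inv_cancel_left]
      exact (hz.pow_of_coprime _ (ZMod.val_coe_unit_coprime i.1)).eq_orderOf.symm⟩
  have hg : Function.Injective g := by
    intro i₁ i₂ h
    have h' : u⁻¹ * z ^ (i₁.1 : ZMod (t * m)).val = u⁻¹ * z ^ (i₂.1 : ZMod (t * m)).val :=
      congrArg (fun x => ((x.1 : rootsOfUnity t ℂ) : ℂˣ)) h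
    exact Subtype.ext (Units.ext (ZMod.val_injective _
      (hz.pow_inj (ZMod.val_lt _) (ZMod.val_lt _) (mul_left_cancel h'))))
  refine le_trans ?_ (Nat.card_le_card_of_injective g hg)
  rw [f.card_preimage_of_surjective hf (· = j), Nat.card_unique, one_mul]
  have h1 := f.card_preimage_of_surjective hf (fun _ => True)
  simp only [Nat.card_congr (Equiv.subtypeUnivEquiv fun _ => trivial),
    Nat.card_eq_fintype_card (α := (ZMod _)ˣ), ZMod.card_units_eq_totient] at h1
  have h2 := Nat.totient_super_multiplicative t m
  rw [h1, mul_comm] at h2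
  exact Nat.le_of_mul_le_mul_left h2 (Nat.totient_pos.mpr (NeZero.pos m))

/-- Evaluation of the characters of a finite abelian group at `q`, with values in the roots of
unity of order dividing the order of `q`. -/
def evalRootsOfUnity {Q : Type*} [CommGroup Q] (q : Q) :
    (Q →* ℂˣ) →* rootsOfUnity (orderOf q) ℂ where
  toFun ψ := ⟨ψ q, by rw [mem_rootsOfUnity, ← map_pow, pow_orderOf_eq_one, map_one]⟩
  map_one' := rfl
  map_mul' _ _ := rfl

theorem exists_monoidHom_apply_eq {Q : Type*} [CommGroup Q] [Finite Q] (q : Q) (ζ : ℂˣ)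
    (hζ : orderOf ζ ∣ orderOf q) : ∃ ψ : Q →* ℂˣ, ψ q = ζ := by
  have : NeZero (Monoid.exponent Q) := ⟨Monoid.exponent_ne_zero_of_finite⟩
  let q' : Subgroup.zpowers q := ⟨q, Subgroup.mem_zpowers q⟩
  have hq' : ∀ x : Subgroup.zpowers q, x ∈ Subgroup.zpowers q' := by
    rintro ⟨x, k, rfl⟩
    exact ⟨k, rfl⟩
  have ho : orderOf ζ ∣ orderOf q' := by rwa [Subgroup.orderOf_mk]
  obtain ⟨ψ, hψ⟩ := MonoidHom.domRestrict_surjective ℂ (Subgroup.zpowers q)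
    (monoidHomOfForallMemZpowers hq' ho)
  refine ⟨ψ, ?_⟩
  have := DFunLike.congr_fun hψ q'
  rwa [monoidHomOfForallMemZpowers_apply_gen] at this

theorem evalRootsOfUnity_surjective {Q : Type*} [CommGroup Q] [Finite Q] (q : Q) :
    Function.Surjective (evalRootsOfUnity q) := by
  rintro ⟨ζ, hζ⟩
  obtain ⟨ψ, hψ⟩ := exists_monoidHom_apply_eq q ζ (orderOf_dvd_of_pow_eq_one hζ)
  exact ⟨ψ, Subtype.ext hψ⟩

theorem totient_card_le_card_monoidHom {Q : Type*} [CommGroup Q] [Finite Q] (q : Q) {m : ℕ}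
    (hm : m ≠ 0) (u : ℂˣ) (hu : orderOf (u ^ orderOf q) = m) :
    Nat.totient (Nat.card Q) ≤
      Nat.card {ψ : Q →* ℂˣ // orderOf (u * ψ q) = orderOf q * m} := by
  have : NeZero (Monoid.exponent Q) := ⟨Monoid.exponent_ne_zero_of_finite⟩
  have ht : orderOf q ≠ 0 := (orderOf_pos q).ne'
  have : NeZero (orderOf q) := ⟨ht⟩
  have hs := evalRootsOfUnity_surjective q
  have h1 := (evalRootsOfUnity q).card_preimage_of_surjective hs (fun _ => True)
  simp only [Nat.card_congr (Equiv.subtypeUnivEquiv fun _ => trivial),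
    CommGroup.card_monoidHom_of_hasEnoughRootsOfUnity,
    HasEnoughRootsOfUnity.natCard_rootsOfUnity] at h1
  have h2 := (evalRootsOfUnity q).card_preimage_of_surjective hs
    (fun ζ => orderOf (u * (ζ : ℂˣ)) = orderOf q * m)
  refine le_of_le_of_eq ?_ h2.symm
  rw [h1, mul_comm (Nat.card _)]
  exact (Nat.totient_mul_le_mul_totient _ _).trans
    (Nat.mul_le_mul_left _ (totient_le_card_rootsOfUnity_orderOf_mul ht hm u hu))

theorem exists_zpow_eq_of_orderOf_eq_exponent {G : Type*} [CommGroup G] [Finite G] (χ : G →* ℂˣ)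
    {a : G} (ha : orderOf (χ a) = Monoid.exponent G) (g : G) : ∃ k : ℤ, χ (a ^ k) = χ g := by
  have : NeZero (Monoid.exponent G) := ⟨Monoid.exponent_ne_zero_of_finite⟩
  have hp : IsPrimitiveRoot (χ a) (Monoid.exponent G) := IsPrimitiveRoot.iff_orderOf.mpr ha
  have hg : χ g ∈ Subgroup.zpowers (χ a) := by
    rw [hp.zpowers_eq, mem_rootsOfUnity, ← map_pow, Monoid.pow_exponent_eq_one, map_one]
  obtain ⟨k, hk⟩ := hg
  exact ⟨k, by rw [map_zpow]; exact hk⟩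

theorem isComplementOf_ker_zpowers {G : Type*} [CommGroup G] [Finite G] (χ : G →* ℂˣ)
    {a : G} (ha : orderOf (χ a) = Monoid.exponent G) :
    IsComplementOf χ.ker (Subgroup.zpowers a) := by
  constructor
  · rw [eq_top_iff]
    intro g _
    obtain ⟨k, hk⟩ := exists_zpow_eq_of_orderOf_eq_exponent χ ha g
    refine Subgroup.mem_sup.mpr ⟨a ^ k, ⟨k, rfl⟩, (a ^ k)⁻¹ * g, ?_, mul_inv_cancel_left _ _⟩
    rw [MonoidHom.mem_ker, map_mul, map_inv, hk, inv_mul_cancel]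
  · rw [eq_bot_iff]
    rintro _ ⟨⟨k, rfl⟩, hk⟩
    have hk' : χ a ^ k = 1 := by rw [← map_zpow]; exact hk
    rw [← orderOf_dvd_iff_zpow_eq_one, ha] at hk'
    exact orderOf_dvd_iff_zpow_eq_one.mp
      ((Int.natCast_dvd_natCast.mpr (Monoid.order_dvd_exponent a)).trans hk')

theorem exists_zpowers_eq_of_card_eq_exponent {G : Type*} [CommGroup G] [Finite G]
    (A : Subgroup G) (hA : IsCyclic A) (hAe : Nat.card A = Monoid.exponent G) :
    ∃ a : G, Subgroup.zpowers a = A ∧ orderOf a = Monoid.exponent G := by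
  obtain ⟨a, ha⟩ := (Subgroup.isCyclic_iff_exists_zpowers_eq_top A).mp hA
  exact ⟨a, ha, by rw [← Nat.card_zpowers, ha, hAe]⟩

/-- Let `A`, `B` be cyclic subgroups of maximal order (order equal to the exponent) of a
finite abelian group `G`, of common index `s = |G : A| = |G : B|`.  Then the number of
common complements of `A` and `B` in `G` is at least `φ(s)`; equivalently, since `A` has
exactly `s` complements in `G`, the proportion of complements of `A` that are
simultaneously complements of `B` is at least `φ(s)/s`. -/
theorem card_common_complements_ge_totient
    {G : Type*} [CommGroup G] [Fintype G]
    (A B : Subgroup G) (hA : IsCyclic ↥A) (hB : IsCyclic ↥B)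
    (hAe : Nat.card A = Monoid.exponent G) (hBe : Nat.card B = Monoid.exponent G)
    {s : ℕ} (hsA : A.index = s) (hsB : B.index = s) :
    Nat.totient s ≤
      Nat.card {H : Subgroup G // IsComplementOf H A ∧ IsComplementOf H B} := by
  obtain ⟨a, rfl, ha⟩ := exists_zpowers_eq_of_card_eq_exponent A hA hAe
  obtain ⟨b, rfl, hb⟩ := exists_zpowers_eq_of_card_eq_exponent B hB hBe
  have he : Monoid.exponent G ≠ 0 := Monoid.exponent_ne_zero_of_finite
  have : NeZero (Monoid.exponent G) := ⟨he⟩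
  obtain ⟨z₀, hz₀⟩ := HasEnoughRootsOfUnity.exists_primitiveRoot ℂ (Monoid.exponent G)
  obtain ⟨z, rfl⟩ := hz₀.isUnit he
  have hz : IsPrimitiveRoot z (Monoid.exponent G) := IsPrimitiveRoot.coe_units_iff.mp hz₀
  obtain ⟨χ₀, hχ₀⟩ := exists_monoidHom_apply_eq a z (by rw [← hz.eq_orderOf, ha])
  have hχ₀a : orderOf (χ₀ a) = Monoid.exponent G := by rw [hχ₀, ← hz.eq_orderOf]
  let q : G ⧸ Subgroup.zpowers a := QuotientGroup.mk b
  have hqb : orderOf q ∣ Monoid.exponent G :=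
    hb ▸ orderOf_map_dvd (QuotientGroup.mk' (Subgroup.zpowers a)) b
  obtain ⟨m, hm⟩ := hqb
  have hm0 : m ≠ 0 := by rintro rfl; exact he hm
  have hbt : b ^ orderOf q ∈ Subgroup.zpowers a := by
    rw [← QuotientGroup.eq_one_iff, QuotientGroup.mk_pow]
    exact pow_orderOf_eq_one q
  have hu : orderOf (χ₀ b ^ orderOf q) = m := by
    have h1 : orderOf (b ^ orderOf q) = m := by
      rw [orderOf_pow_of_dvd (orderOf_pos q).ne' (hb ▸ ⟨m, hm⟩), hb, hm,
        Nat.mul_div_cancel_left _ (orderOf_pos q)]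
    obtain ⟨k, hk⟩ := (mem_powers_iff_mem_zpowers (x := a)).mpr hbt
    have hk : a ^ k = b ^ orderOf q := hk
    have hfin : IsOfFinOrder (χ₀ a) := by
      rw [← orderOf_pos_iff, hχ₀a]
      exact Nat.pos_of_ne_zero he
    rw [← map_pow, ← hk, map_pow, hfin.orderOf_pow, hχ₀a, ← ha, ← orderOf_pow, hk, h1]
  let χ (ψ : G ⧸ Subgroup.zpowers a →* ℂˣ) : G →* ℂˣ :=
    χ₀ * ψ.comp (QuotientGroup.mk' (Subgroup.zpowers a))
  have hχa (ψ) : χ ψ a = χ₀ a := by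
    have : (QuotientGroup.mk a : G ⧸ Subgroup.zpowers a) = 1 :=
      (QuotientGroup.eq_one_iff a).mpr (Subgroup.mem_zpowers a)
    simp [χ, this]
  have hχo (ψ) : orderOf (χ ψ a) = Monoid.exponent G := by rw [hχa, hχ₀a]
  let F : {ψ : G ⧸ Subgroup.zpowers a →* ℂˣ // orderOf (χ₀ b * ψ q) = orderOf q * m} →
      {H : Subgroup G // IsComplementOf H (Subgroup.zpowers a) ∧
        IsComplementOf H (Subgroup.zpowers b)} := fun ψ =>
    ⟨(χ ψ.1).ker, isComplementOf_ker_zpowers _ (hχo _),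
      isComplementOf_ker_zpowers _ (ψ.2.trans hm.symm)⟩
  have hF : Function.Injective F := by
    intro ψ₁ ψ₂ h
    have hker : (χ ψ₁.1).ker = (χ ψ₂.1).ker := congrArg Subtype.val h
    refine Subtype.ext (MonoidHom.ext fun x => ?_)
    obtain ⟨g, rfl⟩ := QuotientGroup.mk_surjective x
    obtain ⟨k, hk⟩ := exists_zpow_eq_of_orderOf_eq_exponent (χ ψ₁.1) (hχo _) g
    have hk₂ : χ ψ₂.1 (a ^ k) = χ ψ₂.1 g := by
      rw [MonoidHom.eq_iff] at hk ⊢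
      rwa [← hker]
    have hg : χ ψ₁.1 g = χ ψ₂.1 g := by
      rw [← hk, ← hk₂, map_zpow, map_zpow, hχa, hχa]
    exact mul_left_cancel (a := χ₀ g) hg
  rw [← hsA, Subgroup.index_eq_card]
  exact (totient_card_le_card_monoidHom q hm0 (χ₀ b) hu).trans
    (Nat.card_le_card_of_injective F hF)
end

section
/- Let G be a finite abelian group with cyclic subgroups A, B, C such that the Sylow 2-subgroup G₂ of G is nontrivial and satisfies G₂ = A₂ × B₂ = A₂ × C₂ = B₂ × C₂ (internal direct products, where A₂, B₂, C₂ are the Sylow 2-subgroups of A, B, C). Then A, B, C have no common transversal in G. -/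
open Finset in
/-- In a finite cyclic group there is at most one element of order two. -/
theorem IsCyclic.eq_of_sq_eq_one {G : Type*} [Group G] [Finite G] [IsCyclic G] {x y : G}
    (hx : x ^ 2 = 1) (hx1 : x ≠ 1) (hy : y ^ 2 = 1) (hy1 : y ≠ 1) : x = y := by
  classical
  have := Fintype.ofFinite G
  by_contra hxy
  have hsub : ({1, x, y} : Finset G) ⊆ ({a | a ^ 2 = 1} : Finset G) := by
    intro a ha
    simp only [mem_insert, mem_singleton] at ha
    rcases ha with rfl | rfl | rfl <;> simp [*]
  have hcard : #({1, x, y} : Finset G) = 3 :=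
    card_eq_three.mpr ⟨1, x, y, hx1.symm, hy1.symm, hxy, rfl⟩
  have := card_le_card hsub
  have := IsCyclic.card_pow_eq_one_le (α := G) two_pos
  omega

/-- A cyclic subgroup of a finite group has at most one element of order two. -/
theorem Subgroup.eq_of_sq_eq_one_of_isCyclic {G : Type*} [Group G] [Finite G] {H : Subgroup G}
    (hH : IsCyclic H) {x y : G} (hxH : x ∈ H) (hyH : y ∈ H)
    (hx : x ^ 2 = 1) (hx1 : x ≠ 1) (hy : y ^ 2 = 1) (hy1 : y ≠ 1) : x = y := by
  have h : (⟨x, hxH⟩ : H) = ⟨y, hyH⟩ :=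
    IsCyclic.eq_of_sq_eq_one (Subtype.ext hx) (fun h => hx1 (congrArg Subtype.val h))
      (Subtype.ext hy) (fun h => hy1 (congrArg Subtype.val h))
  exact congrArg Subtype.val h

/-- If a finite abelian group has no element of order two other than `z`, and `z ^ 2 = 1`, then the
product of all elements of the group is `z`. -/
theorem prod_univ_eq_of_unique_sq_eq_one {Q : Type*} [CommGroup Q] [Fintype Q] {z : Q}
    (hz : z ^ 2 = 1) (huniq : ∀ x : Q, x ^ 2 = 1 → x ≠ 1 → x = z) :
    ∏ x : Q, x = z := by
  classical
  rw [← Finset.mul_prod_erase Finset.univ (fun x => x) (Finset.mem_univ z)]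
  have hzinv : z⁻¹ = z := inv_eq_of_mul_eq_one_left (by rwa [← sq])
  have h : ∏ x ∈ Finset.univ.erase z, x = 1 := by
    refine Finset.prod_involution (fun x _ => x⁻¹) (fun x _ => mul_inv_cancel x)
      (fun x hx hx1 hxx => Finset.ne_of_mem_erase hx (huniq x ?_ hx1))
      (fun x hx => ?_) (fun x _ => inv_inv x)
    · rw [sq]
      nth_rewrite 1 [← hxx]
      exact inv_mul_cancel x
    · refine Finset.mem_erase.mpr ⟨fun hxz => Finset.ne_of_mem_erase hx ?_, Finset.mem_univ _⟩
      rw [← inv_inv x, hxz, hzinv]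
  rw [h, mul_one]

/-- A nontrivial subgroup of elements of `2`-power order contains an element of order two. -/
theorem Subgroup.exists_sq_eq_one_ne_one {G : Type*} [Group G] {H : Subgroup G}
    (hH : ∀ g ∈ H, ∃ k : ℕ, g ^ 2 ^ k = 1) (hne : H ≠ ⊥) :
    ∃ b ∈ H, b ^ 2 = 1 ∧ b ≠ 1 := by
  obtain ⟨g, hg, hg1⟩ := H.bot_or_exists_ne_one.resolve_left hne
  obtain ⟨k, hk⟩ := hH g hg
  induction k with
  | zero => exact absurd (by simpa using hk) hg1
  | succ k ih =>
    by_cases h : g ^ 2 ^ k = 1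
    · exact ih h
    · exact ⟨_, H.pow_mem hg _, by rwa [← pow_mul, ← pow_succ], h⟩

/-- Modulo a subgroup containing `g ^ 2`, odd powers of `g` agree with `g`. -/
theorem Subgroup.pow_mul_inv_mem_of_odd {G : Type*} [Group G] {H : Subgroup G} {g : G}
    (hg : g ^ 2 ∈ H) {m : ℕ} (hm : Odd m) : g ^ m * g⁻¹ ∈ H := by
  obtain ⟨j, rfl⟩ := hm
  rw [pow_succ, mul_inv_cancel_right, pow_mul]
  exact H.pow_mem hg j

/-- In a finite group, a suitable odd power of every element has `2`-power order. -/
theorem exists_odd_pow_two_pow_eq_one (G : Type*) [Group G] [Finite G] :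
    ∃ m : ℕ, Odd m ∧ ∀ g : G, ∃ k : ℕ, (g ^ m) ^ 2 ^ k = 1 := by
  obtain ⟨k, m, hm, hcard⟩ := Nat.exists_eq_two_pow_mul_odd (n := Nat.card G) Nat.card_pos.ne'
  exact ⟨m, hm, fun g => ⟨k, by rw [← pow_mul, mul_comm, ← hcard, pow_card_eq_one']⟩⟩

/-- The product of a transversal of `A` maps to the product of all elements of `G ⧸ A`. -/
theorem IsTransversal.mk_prod {G : Type*} [CommGroup G] [Fintype G] {A : Subgroup G}
    [Fintype (G ⧸ A)] {T : Set G} [Fintype T] (hT : IsTransversal A T) :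
    (QuotientGroup.mk (∏ t ∈ T.toFinset, t) : G ⧸ A) = ∏ q : G ⧸ A, q := by
  change QuotientGroup.mk' A _ = _
  rw [map_prod]
  refine Finset.prod_bij (fun t _ => QuotientGroup.mk' A t) (fun _ _ => Finset.mem_univ _)
    (fun t ht u hu h => ?_) (fun q _ => ?_) (fun _ _ => rfl)
  · exact (hT u).unique ⟨Set.mem_toFinset.mp ht, h⟩ ⟨Set.mem_toFinset.mp hu, rfl⟩
  · obtain ⟨g, rfl⟩ := QuotientGroup.mk_surjective q
    obtain ⟨t, ⟨ht, h⟩, -⟩ := hT g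
    exact ⟨t, Set.mem_toFinset.mpr ht, h⟩

/-- If the Sylow `2`-subgroup `P` of `G` is the direct product of `A ⊓ P` and the nontrivial
cyclic group `B ⊓ P`, then the product of a transversal of `A` has order two modulo `A`. -/
theorem IsTransversal.prod_notMem_and_sq_mem {G : Type*} [CommGroup G] [Fintype G]
    {A B P : Subgroup G} (hB : IsCyclic B) (hP : ∀ g : G, g ∈ P ↔ ∃ k : ℕ, g ^ 2 ^ k = 1)
    (hsup : A ⊓ P ⊔ B ⊓ P = P) (hinf : A ⊓ P ⊓ (B ⊓ P) = ⊥) (hne : B ⊓ P ≠ ⊥)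
    {T : Set G} [Fintype T] (hT : IsTransversal A T) :
    ∏ t ∈ T.toFinset, t ∉ A ∧ (∏ t ∈ T.toFinset, t) ^ 2 ∈ A := by
  classical
  obtain ⟨b, hb, hb2, hb1⟩ :=
    Subgroup.exists_sq_eq_one_ne_one (H := B ⊓ P) (fun g hg => (hP g).mp hg.2) hne
  have htriv : ∀ {x : G}, x ∈ A → x ∈ B ⊓ P → x = 1 := fun {x} hxA hx =>
    Subgroup.mem_bot.mp (hinf ▸ ⟨⟨hxA, hx.2⟩, hx⟩)
  have hbA : b ∉ A := fun h => hb1 (htriv h hb)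
  have huniq : ∀ q : G ⧸ A, q ^ 2 = 1 → q ≠ 1 → q = QuotientGroup.mk b := by
    intro q hq hq1
    obtain ⟨g, rfl⟩ := QuotientGroup.mk_surjective q
    rw [← QuotientGroup.mk_pow, QuotientGroup.eq_one_iff] at hq
    rw [ne_eq, QuotientGroup.eq_one_iff] at hq1
    obtain ⟨m, hm, hpow⟩ := exists_odd_pow_two_pow_eq_one G
    have hgm := Subgroup.pow_mul_inv_mem_of_odd hq hm
    have hgP : g ^ m ∈ A ⊓ P ⊔ B ⊓ P := hsup.symm ▸ (hP _).mpr (hpow g)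
    obtain ⟨a, ha, c, hc, hac⟩ := Subgroup.mem_sup.mp hgP
    have hcg : g⁻¹ * c ∈ A := by
      have : g⁻¹ * c = a⁻¹ * (g ^ m * g⁻¹) := by rw [← hac]; group; simp [mul_comm]
      exact this ▸ A.mul_mem (A.inv_mem ha.1) hgm
    have hc2 : c ^ 2 ∈ A := by
      have : c ^ 2 = (g⁻¹ * c) ^ 2 * g ^ 2 := by rw [← mul_pow]; simp [mul_comm]
      exact this ▸ A.mul_mem (A.pow_mem hcg 2) hq
    have hc1 : c ≠ 1 := by
      rintro rfl
      exact hq1 (by simpa using hcg)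
    have hcb : c = b := Subgroup.eq_of_sq_eq_one_of_isCyclic hB hc.1 hb.1
      (htriv hc2 ((B ⊓ P).pow_mem hc 2)) hc1 hb2 hb1
    exact QuotientGroup.eq.mpr (hcb ▸ hcg)
  have hprod := hT.mk_prod.trans (prod_univ_eq_of_unique_sq_eq_one
    (z := (QuotientGroup.mk b : G ⧸ A)) (by rw [← QuotientGroup.mk_pow, hb2]; rfl) huniq)
  rw [← QuotientGroup.eq_one_iff, ← QuotientGroup.eq_one_iff (N := A), QuotientGroup.mk_pow,
    hprod, ← QuotientGroup.mk_pow, hb2, QuotientGroup.eq_one_iff]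
  exact ⟨hbA, rfl⟩

/-- Let `A`, `B`, `C` be cyclic subgroups of a finite abelian group `G` whose Sylow
`2`-subgroup `G₂` is nontrivial and satisfies
`G₂ = A₂ × B₂ = A₂ × C₂ = B₂ × C₂` (internal direct products, where `A₂`, `B₂`, `C₂` are
the Sylow `2`-subgroups of `A`, `B`, `C`).  Then `A`, `B`, `C` have no common transversal
in `G`. -/
theorem no_common_transversal_of_sylow_two_products
    {G : Type*} [CommGroup G] [Fintype G] (A B C : Subgroup G)
    (hA : IsCyclic ↥A) (hB : IsCyclic ↥B) (hC : IsCyclic ↥C)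
    (G2 : Subgroup G) (hG2 : ∀ g : G, g ∈ G2 ↔ ∃ k : ℕ, g ^ 2 ^ k = 1)
    (A2 B2 C2 : Subgroup G)
    (hA2 : A2 = A ⊓ G2) (hB2 : B2 = B ⊓ G2) (hC2 : C2 = C ⊓ G2)
    (hnt : G2 ≠ ⊥)
    (hAB : A2 ⊔ B2 = G2) (hAB' : A2 ⊓ B2 = ⊥)
    (hAC : A2 ⊔ C2 = G2) (hAC' : A2 ⊓ C2 = ⊥)
    (hBC : B2 ⊔ C2 = G2) (hBC' : B2 ⊓ C2 = ⊥) :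
    ¬ ∃ T : Set G, IsTransversal A T ∧ IsTransversal B T ∧ IsTransversal C T := by
  classical
  rintro ⟨T, hTA, hTB, hTC⟩
  subst hA2 hB2 hC2
  have hA2ne : A ⊓ G2 ≠ ⊥ := fun h => by
    rw [h, bot_sup_eq] at hAB hAC
    rw [hAB, hAC, inf_idem] at hBC'
    exact hnt hBC'
  have hB2ne : B ⊓ G2 ≠ ⊥ := fun h => by
    rw [h, sup_bot_eq] at hAB
    rw [h, bot_sup_eq] at hBC
    rw [hAB, hBC, inf_idem] at hAC'
    exact hnt hAC'
  have hC2ne : C ⊓ G2 ≠ ⊥ := fun h => by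
    rw [h, sup_bot_eq] at hAC hBC
    rw [hAC, hBC, inf_idem] at hAB'
    exact hnt hAB'
  obtain ⟨hsA, hsA2⟩ := hTA.prod_notMem_and_sq_mem hB hG2 hAB hAB' hB2ne
  obtain ⟨hsB, hsB2⟩ := hTB.prod_notMem_and_sq_mem hA hG2 ((sup_comm _ _).trans hAB)
    ((inf_comm _ _).trans hAB') hA2ne
  obtain ⟨hsC, hsC2⟩ := hTC.prod_notMem_and_sq_mem hA hG2 ((sup_comm _ _).trans hAC)
    ((inf_comm _ _).trans hAC') hA2ne
  generalize ∏ t ∈ T.toFinset, t = s at *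
  obtain ⟨m, hm, hpow⟩ := exists_odd_pow_two_pow_eq_one G
  have hu : ∀ {H : Subgroup G}, s ∉ H → s ^ 2 ∈ H → s ^ m ∉ H := fun {H} h h2 hmem =>
    h (H.inv_mem_iff.mp
      ((H.mul_mem_cancel_left hmem).mp (Subgroup.pow_mul_inv_mem_of_odd h2 hm)))
  have huA := hu hsA hsA2
  have huB := hu hsB hsB2
  have huC := hu hsC hsC2
  have huG2 : s ^ m ∈ G2 := (hG2 _).mpr (hpow s)
  have hAB1 : ∀ {x : G}, x ∈ A ⊓ G2 → x ∈ B ⊓ G2 → x = 1 := fun hx hy =>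
    Subgroup.mem_bot.mp (hAB' ▸ ⟨hx, hy⟩)
  have hsq : ∀ {a b : G}, a ∈ A ⊓ G2 → b ∈ B ⊓ G2 → (a * b) ^ 2 = 1 → a ^ 2 = 1 ∧ b ^ 2 = 1 := by
    intro a b ha hb hab
    rw [mul_pow] at hab
    have ha2 : a ^ 2 = 1 := hAB1 ((A ⊓ G2).pow_mem ha 2)
      (eq_inv_of_mul_eq_one_left hab ▸ (B ⊓ G2).inv_mem ((B ⊓ G2).pow_mem hb 2))
    exact ⟨ha2, by simpa [ha2] using hab⟩
  have hu2 : (s ^ m) ^ 2 = 1 := by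
    rw [← pow_mul, mul_comm, pow_mul]
    have hG : (s ^ 2) ^ m ∈ G2 := by
      rw [← pow_mul, mul_comm, pow_mul]
      exact G2.pow_mem huG2 2
    exact hAB1 ⟨A.pow_mem hsA2 m, hG⟩ ⟨B.pow_mem hsB2 m, hG⟩
  obtain ⟨a, ha, b, hb, hab⟩ := Subgroup.mem_sup.mp (hAB.symm ▸ huG2)
  obtain ⟨c, hc, hc2, hc1⟩ :=
    Subgroup.exists_sq_eq_one_ne_one (H := C ⊓ G2) (fun g hg => (hG2 g).mp hg.2) hC2ne
  obtain ⟨a', ha', b', hb', hab'⟩ := Subgroup.mem_sup.mp (hAB.symm ▸ hc.2)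
  obtain ⟨ha2, hb2⟩ := hsq ha hb (hab.symm ▸ hu2)
  obtain ⟨ha2', hb2'⟩ := hsq ha' hb' (hab'.symm ▸ hc2)
  have ha1 : a ≠ 1 := by
    rintro rfl
    exact huB (hab ▸ (one_mul b).symm ▸ hb.1)
  have hb1 : b ≠ 1 := by
    rintro rfl
    exact huA (hab ▸ (mul_one a).symm ▸ ha.1)
  have ha1' : a' ≠ 1 := by
    rintro rfl
    rw [one_mul] at hab'
    exact hc1 (Subgroup.mem_bot.mp (hBC' ▸ ⟨hab' ▸ hb', hc⟩))
  have hb1' : b' ≠ 1 := by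
    rintro rfl
    rw [mul_one] at hab'
    exact hc1 (Subgroup.mem_bot.mp (hAC' ▸ ⟨hab' ▸ ha', hc⟩))
  have haa := Subgroup.eq_of_sq_eq_one_of_isCyclic hA ha.1 ha'.1 ha2 ha1 ha2' ha1'
  have hbb := Subgroup.eq_of_sq_eq_one_of_isCyclic hB hb.1 hb'.1 hb2 hb1 hb2' hb1'
  exact huC (by rw [← hab, haa, hbb, hab']; exact hc.1)
end

section
/- Let G be a finite abelian group, let B₁, …, B_t be subgroups of G of the same order m, and let X = B₁B₂⋯B_t. Assume B₁, …, B_t have a common transversal in X. If A is a subgroup of G with |A| = m such that AX is the internal direct product A × X (i.e., A ∩ X = 1), then A, B₁, …, B_t have a common transversal in G. -/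
theorem isTransversal_iff {G : Type*} [CommGroup G] (A : Subgroup G) (T : Set G) :
    IsTransversal A T ↔
      (∀ g, ∃ s ∈ T, g / s ∈ A) ∧ ∀ s ∈ T, ∀ s' ∈ T, s / s' ∈ A → s = s' := by
  have key (x y : G) : (QuotientGroup.mk x : G ⧸ A) = QuotientGroup.mk y ↔ y / x ∈ A := by
    rw [QuotientGroup.eq, div_eq_inv_mul]
  simp only [IsTransversal, key]
  constructor
  · refine fun h => ⟨fun g => ?_, fun s hs s' hs' hss => ?_⟩
    · obtain ⟨s, hs, -⟩ := h g
      exact ⟨s, hs⟩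
    · exact (h s).unique ⟨hs, by simp⟩ ⟨hs', hss⟩
  · rintro ⟨hex, huniq⟩ g
    obtain ⟨s, hs, hgs⟩ := hex g
    refine ⟨s, ⟨hs, hgs⟩, fun s' ⟨hs', hgs'⟩ => huniq s' hs' s hs ?_⟩
    simpa using A.div_mem hgs hgs'

theorem exists_isTransversal {G : Type*} [Group G] (A : Subgroup G) :
    ∃ T : Set G, IsTransversal A T := by
  refine ⟨Set.range (Quotient.out : G ⧸ A → G), fun g => ?_⟩
  refine ⟨(g : G ⧸ A).out, ⟨⟨_, rfl⟩, QuotientGroup.out_eq' _⟩, ?_⟩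
  rintro _ ⟨⟨q, rfl⟩, hq⟩
  rw [← hq, QuotientGroup.out_eq']

/-- If `A ⊓ X = ⊥`, elements of `AX` have unique components in `A` and `X`. -/
theorem eq_and_eq_of_mul_eq_mul {G : Type*} [CommGroup G] {A X : Subgroup G} (h : A ⊓ X = ⊥)
    {a a' x x' : G} (ha : a ∈ A) (ha' : a' ∈ A) (hx : x ∈ X) (hx' : x' ∈ X)
    (e : a * x = a' * x') : a = a' ∧ x = x' := by
  have := Subgroup.mul_injective_of_disjoint (disjoint_iff.mpr h)
    (a₁ := (⟨a, ha⟩, ⟨x, hx⟩)) (a₂ := (⟨a', ha'⟩, ⟨x', hx'⟩)) e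
  simpa using this

/-- Let `B₁, …, B_t` be subgroups of the same order `m` of a finite abelian group `G` and
let `X = B₁B₂⋯B_t`.  Assume `B₁, …, B_t` have a common transversal in `X`.  If `A ≤ G`
with `|A| = m` and `AX = A × X` (i.e. `A ∩ X = 1`), then `A, B₁, …, B_t` have a common
transversal in `G`. -/
theorem common_transversal_with_disjoint_subgroup
    {G : Type*} [CommGroup G] [Fintype G] {t : ℕ} (B : Fin t → Subgroup G)
    {m : ℕ} (hm : ∀ i, Nat.card (B i) = m)
    (X : Subgroup G) (hX : X = ⨆ i, B i)
    (hT : ∃ T : Set ↥X, ∀ i, IsTransversal ((B i).subgroupOf X) T)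
    (A : Subgroup G) (hA : Nat.card A = m) (hAX : A ⊓ X = ⊥) :
    ∃ T : Set G, IsTransversal A T ∧ ∀ i, IsTransversal (B i) T := by
  obtain ⟨T, hT⟩ := hT
  rcases t.eq_zero_or_pos with rfl | ht
  · obtain ⟨S, hS⟩ := exists_isTransversal A
    exact ⟨S, hS, fun i => i.elim0⟩
  have hB (i) : B i ≤ X := hX ▸ le_iSup B i
  simp only [isTransversal_iff, Subgroup.mem_subgroupOf, Subgroup.coe_div] at hT
  obtain ⟨R, hR⟩ := exists_isTransversal (A ⊔ X)
  rw [isTransversal_iff] at hR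
  obtain ⟨hRex, hRuniq⟩ := hR
  let i₀ : Fin t := ⟨0, ht⟩
  obtain ⟨φ⟩ : Nonempty (B i₀ ≃ A) := Finite.card_eq.mp ((hm i₀).trans hA.symm)
  -- An element of `S` is determined by its `B i₀`, `T` and `R` components.
  let S : Set G := {g | ∃ b : B i₀, ∃ τ ∈ T, ∃ r ∈ R, g = φ b * (b * τ) * r}
  have hbτ (b : B i₀) (τ : X) : (b * τ : G) ∈ X := X.mul_mem (hB i₀ b.2) τ.2
  have hmem (b : B i₀) (τ : X) : (φ b * (b * τ) : G) ∈ A ⊔ X :=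
    Subgroup.mul_mem_sup (φ b).2 (hbτ b τ)
  have hdecomp (g : G) : ∃ a ∈ A, ∃ x ∈ X, ∃ r ∈ R, g = a * x * r := by
    obtain ⟨r, hr, h⟩ := hRex g
    obtain ⟨a, ha, x, hx, e⟩ := Subgroup.mem_sup.mp h
    exact ⟨a, ha, x, hx, r, hr, by rw [e, div_mul_cancel]⟩
  have hr_eq (C : Subgroup G) (hC : C ≤ A ⊔ X) (b b' : B i₀) (τ τ' : X) (r r' : G)
      (hr : r ∈ R) (hr' : r' ∈ R)
      (h : (φ b : G) * (b * τ) * r / (φ b' * (b' * τ') * r') ∈ C) : r = r' := by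
    refine hRuniq r hr r' hr' ?_
    rw [mul_div_mul_comm] at h
    exact (Subgroup.mul_mem_cancel_left _ ((A ⊔ X).div_mem (hmem b τ) (hmem b' τ'))).mp (hC h)
  refine ⟨S, (isTransversal_iff A S).mpr ⟨fun g => ?_, ?_⟩,
    fun i => (isTransversal_iff (B i) S).mpr ⟨fun g => ?_, ?_⟩⟩
  · obtain ⟨a, ha, x, hx, r, hr, rfl⟩ := hdecomp g
    obtain ⟨τ, hτ, h⟩ := (hT i₀).1 ⟨x, hx⟩
    refine ⟨_, ⟨⟨_, h⟩, τ, hτ, r, hr, rfl⟩, ?_⟩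
    simpa using A.div_mem ha (φ _).2
  · rintro _ ⟨b, τ, hτ, r, hr, rfl⟩ _ ⟨b', τ', hτ', r', hr', rfl⟩ h
    obtain rfl := hr_eq A le_sup_left b b' τ τ' r r' hr hr' h
    rw [mul_div_mul_right_eq_div] at h
    have e : (b * τ : G) = b' * τ' :=
      (eq_and_eq_of_mul_eq_mul hAX (φ b).2 (A.mul_mem h (φ b').2) (hbτ b τ) (hbτ b' τ')
        (by rw [mul_assoc, div_mul_cancel])).2
    obtain rfl : τ = τ' := (hT i₀).2 τ hτ τ' hτ' (by
      rw [div_eq_div_iff_mul_eq_mul.mpr (show (τ : G) * b = b' * τ' by rw [mul_comm, e])]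
      exact (B i₀).div_mem b'.2 b.2)
    obtain rfl : b = b' := Subtype.ext (mul_right_cancel e)
    rfl
  · obtain ⟨a, ha, x, hx, r, hr, rfl⟩ := hdecomp g
    obtain ⟨b, hb⟩ := φ.surjective ⟨a, ha⟩
    obtain ⟨τ, hτ, h⟩ := (hT i).1 ⟨x / b, X.div_mem hx (hB i₀ b.2)⟩
    refine ⟨_, ⟨b, τ, hτ, r, hr, rfl⟩, ?_⟩
    simpa [hb, div_div] using h
  · rintro _ ⟨b, τ, hτ, r, hr, rfl⟩ _ ⟨b', τ', hτ', r', hr', rfl⟩ h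
    obtain rfl := hr_eq (B i) ((hB i).trans le_sup_right) b b' τ τ' r r' hr hr' h
    rw [mul_div_mul_right_eq_div] at h
    have hφ : (φ b : G) = φ b' :=
      (eq_and_eq_of_mul_eq_mul hAX (φ b).2 (φ b').2 (hbτ b τ) (X.mul_mem (hB i h) (hbτ b' τ'))
        (by rw [mul_left_comm (φ b' : G) _ _, div_mul_cancel])).1
    obtain rfl : b = b' := φ.injective (Subtype.ext hφ)
    obtain rfl : τ = τ' := (hT i).2 τ hτ τ' hτ' (by simpa using h)
    rfl
end
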